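/- Let n ≥ 2 and let (O,C) with O,C ⊆ [n] be a type C opener-closer configuration (|O∩[k]| ≥ |C∩[k+1]| for all k∈{0,…,n−1}). Then there exists a non-crossing set partition 𝓑 of type D_n with op(𝓑) = O and cl(𝓑) = C if and only if |O| − |C| is even or n ∈ O ∩ C. Moreover, if both |O| − |C| is even and n ∈ O ∩ C, then there exist exactly two such non-crossing set partitions of type D_n; otherwise (whenever one exists) it is unique. -/

import Mathlib

open scoped Classical
noncomputable section

/-! ### Set partitions of type A -/

/-- A set partition of `[n] = {1,…,n}`: pairwise disjoint nonempty blocks covering `[n]`. -/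
structure SetPartitionA (n : ℕ) where
  blocks : Finset (Finset ℕ)
  nonempty : ∀ B ∈ blocks, B.Nonempty
  disj : ∀ B ∈ blocks, ∀ B' ∈ blocks, B ≠ B' → Disjoint B B'
  cover : ∀ i : ℕ, (∃ B ∈ blocks, i ∈ B) ↔ i ∈ Finset.Icc 1 n

/-- Two arcs `(i,j)`, `(i',j')` cross if `i<i'<j<j'` (in either order of the two arcs). -/
def ACross (a b : ℕ × ℕ) : Prop :=
  (a.1 < b.1 ∧ b.1 < a.2 ∧ a.2 < b.2) ∨ (b.1 < a.1 ∧ a.1 < b.2 ∧ b.2 < a.2)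

/-- Two arcs `(i,j)`, `(i',j')` nest if `i<i'<j'<j` (in either order of the two arcs). -/
def ANest (a b : ℕ × ℕ) : Prop :=
  (a.1 < b.1 ∧ b.1 < b.2 ∧ b.2 < a.2) ∨ (b.1 < a.1 ∧ a.1 < a.2 ∧ a.2 < b.2)

namespace SetPartitionA

variable {n : ℕ}

/-- Openers: elements of `[n]` that are not the maximum of their block. -/
def openers (P : SetPartitionA n) : Finset ℕ :=
  (Finset.Icc 1 n).filter fun i => ∃ B ∈ P.blocks, i ∈ B ∧ ∃ j ∈ B, i < j

/-- Closers: elements of `[n]` that are not the minimum of their block. -/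
def closers (P : SetPartitionA n) : Finset ℕ :=
  (Finset.Icc 1 n).filter fun i => ∃ B ∈ P.blocks, i ∈ B ∧ ∃ j ∈ B, j < i

/-- `(i,j)` is an arc: `i < j` are in the same block with no block element in between. -/
def IsArc (P : SetPartitionA n) (i j : ℕ) : Prop :=
  i < j ∧ ∃ B ∈ P.blocks, i ∈ B ∧ j ∈ B ∧ ∀ k ∈ B, ¬(i < k ∧ k < j)

/-- The finite set of arcs of `P`. -/
def arcs (P : SetPartitionA n) : Finset (ℕ × ℕ) :=
  ((Finset.Icc 1 n) ×ˢ (Finset.Icc 1 n)).filter fun p => P.IsArc p.1 p.2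

/-- The number of crossings: pairs of arcs `(i,j)`, `(i',j')` with `i<i'<j<j'`. -/
def crossings (P : SetPartitionA n) : ℕ :=
  ((P.arcs ×ˢ P.arcs).filter fun q =>
    q.1.1 < q.2.1 ∧ q.2.1 < q.1.2 ∧ q.1.2 < q.2.2).card

/-- The number of nestings: pairs of arcs `(i,j)`, `(i',j')` with `i<i'<j'<j`. -/
def nestings (P : SetPartitionA n) : ℕ :=
  ((P.arcs ×ˢ P.arcs).filter fun q =>
    q.1.1 < q.2.1 ∧ q.2.1 < q.2.2 ∧ q.2.2 < q.1.2).card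

/-- The cardinality of a maximal crossing: largest set of mutually crossing arcs. -/
def maxCrossing (P : SetPartitionA n) : ℕ :=
  (P.arcs.powerset.filter fun S => ∀ a ∈ S, ∀ b ∈ S, a ≠ b → ACross a b).sup Finset.card

/-- The cardinality of a maximal nesting: largest set of mutually nesting arcs. -/
def maxNesting (P : SetPartitionA n) : ℕ :=
  (P.arcs.powerset.filter fun S => ∀ a ∈ S, ∀ b ∈ S, a ≠ b → ANest a b).sup Finset.card

end SetPartitionA

/-! ### Set partitions of classical types B/C/D on `[±n]` -/

/-- Position of `i ∈ [±n]` in the type `C` nesting order `1<⋯<n<-n<⋯<-1`. -/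
def nestOrd (n : ℕ) (i : ℤ) : ℤ := if 0 < i then i else 2 * n + 1 + i

/-- Position of `i ∈ [±n]` in the crossing order `1<⋯<n<-1<⋯<-n`. -/
def crossOrd (n : ℕ) (i : ℤ) : ℤ := if 0 < i then i else (n : ℤ) - i

/-- Position of `i ∈ [±n] ∪ {0}` in the type `B` nesting order `1<⋯<n<0<-n<⋯<-1`. -/
def nestOrdB (n : ℕ) (i : ℤ) : ℤ :=
  if 0 < i then i else if i = 0 then (n : ℤ) + 1 else 2 * n + 2 + i

/-- The negative `-B` of a block. -/
def negSet (B : Finset ℤ) : Finset ℤ := B.image fun x => -x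

/-- A set partition of type `B_n`/`C_n`: a set partition of `[±n]` with `B ∈ 𝓑 ↔ -B ∈ 𝓑`
and at most one block `B₀` with `B₀ = -B₀`. -/
structure SetPartitionC (n : ℕ) where
  blocks : Finset (Finset ℤ)
  nonempty : ∀ B ∈ blocks, B.Nonempty
  disj : ∀ B ∈ blocks, ∀ B' ∈ blocks, B ≠ B' → Disjoint B B'
  cover : ∀ i : ℤ, (∃ B ∈ blocks, i ∈ B) ↔ (i ≠ 0 ∧ |i| ≤ (n : ℤ))
  symm : ∀ B ∈ blocks, negSet B ∈ blocks
  zeroBlock : ∀ B ∈ blocks, ∀ B' ∈ blocks, negSet B = B → negSet B' = B' → B = B'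

/-- Endpoints of an arc, ordered by the crossing order. -/
def cpr (n : ℕ) (p : ℤ × ℤ) : ℤ × ℤ :=
  (min (crossOrd n p.1) (crossOrd n p.2), max (crossOrd n p.1) (crossOrd n p.2))

/-- `p` crosses `q` with `p` coming first in the crossing order. -/
def CrossRel (n : ℕ) (p q : ℤ × ℤ) : Prop :=
  (cpr n p).1 < (cpr n q).1 ∧ (cpr n q).1 < (cpr n p).2 ∧ (cpr n p).2 < (cpr n q).2

/-- The two arcs `p`, `q` cross in the crossing diagram. -/
def Crosses (n : ℕ) (p q : ℤ × ℤ) : Prop := CrossRel n p q ∨ CrossRel n q p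

/-- `p` nests over `q` in the nesting diagram (arcs written in nesting order). -/
def NestRel (n : ℕ) (p q : ℤ × ℤ) : Prop :=
  nestOrd n p.1 < nestOrd n q.1 ∧ nestOrd n q.2 < nestOrd n p.2

/-- The two arcs `p`, `q` nest in the nesting diagram. -/
def Nests (n : ℕ) (p q : ℤ × ℤ) : Prop := NestRel n p q ∨ NestRel n q p

/-- `p` nests over `q` in the type `B` nesting diagram. -/
def NestRelB (n : ℕ) (p q : ℤ × ℤ) : Prop :=
  nestOrdB n p.1 < nestOrdB n q.1 ∧ nestOrdB n q.2 < nestOrdB n p.2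

/-- The two arcs `p`, `q` nest in the type `B` nesting diagram. -/
def NestsB (n : ℕ) (p q : ℤ × ℤ) : Prop := NestRelB n p q ∨ NestRelB n q p

/-- Exceptional pairs for type `B` crossings: both arcs have positive opener and negative
closer, and at least one closer is smaller in absolute value than its opener. -/
def ExcCross (p q : ℤ × ℤ) : Prop :=
  0 < p.1 ∧ p.2 < 0 ∧ 0 < q.1 ∧ q.2 < 0 ∧ (|p.2| < |p.1| ∨ |q.2| < |q.1|)

/-- Exceptional pairs for type `B` nestings: both arcs have positive opener (or begin at `0`)
and negative closer (or end at `0`), and at least one closer is smaller in absolute value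
than its opener. -/
def ExcNest (p q : ℤ × ℤ) : Prop :=
  0 ≤ p.1 ∧ p.2 ≤ 0 ∧ 0 ≤ q.1 ∧ q.2 ≤ 0 ∧ (|p.2| < |p.1| ∨ |q.2| < |q.1|)

/-- A block augmented by `0` if it is the zero block. -/
def augB (B : Finset ℤ) : Finset ℤ := if negSet B = B then insert 0 B else B

/-- The arc `p` contains `n`. -/
def ContainsN (n : ℕ) (p : ℤ × ℤ) : Prop := p.1 = (n : ℤ) ∨ p.2 = (n : ℤ)

/-- The arc `p` contains `-n`. -/
def ContainsNegN (n : ℕ) (p : ℤ × ℤ) : Prop := p.1 = -(n : ℤ) ∨ p.2 = -(n : ℤ)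

namespace SetPartitionC

variable {n : ℕ}

/-- The ground set `[±n]` as a finset of integers. -/
def pmn (n : ℕ) : Finset ℤ := (Finset.Icc (-(n : ℤ)) (n : ℤ)).erase 0

/-- `(i,j)` is an arc: `i`, `j` are consecutive elements of a block in the nesting order. -/
def IsArc (P : SetPartitionC n) (i j : ℤ) : Prop :=
  nestOrd n i < nestOrd n j ∧ ∃ B ∈ P.blocks, i ∈ B ∧ j ∈ B ∧
    ∀ k ∈ B, ¬(nestOrd n i < nestOrd n k ∧ nestOrd n k < nestOrd n j)

/-- The finite set of arcs of `P` (written in nesting order). -/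
def arcs (P : SetPartitionC n) : Finset (ℤ × ℤ) :=
  (pmn n ×ˢ pmn n).filter fun p => P.IsArc p.1 p.2

/-- Openers: positive elements that are not maximal in their block w.r.t. the nesting order. -/
def openers (P : SetPartitionC n) : Finset ℤ :=
  (Finset.Icc 1 (n : ℤ)).filter fun i =>
    ∃ B ∈ P.blocks, i ∈ B ∧ ∃ j ∈ B, nestOrd n i < nestOrd n j

/-- Closers: positive elements that are not minimal in their block w.r.t. the nesting order. -/
def closers (P : SetPartitionC n) : Finset ℤ :=
  (Finset.Icc 1 (n : ℤ)).filter fun i =>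
    ∃ B ∈ P.blocks, i ∈ B ∧ ∃ j ∈ B, nestOrd n j < nestOrd n i

/-- The number of crossings of a type `C` set partition. -/
def crossings (P : SetPartitionC n) : ℕ :=
  ((P.arcs ×ˢ P.arcs).filter fun q => CrossRel n q.1 q.2).card

/-- The number of nestings of a type `C` set partition. -/
def nestings (P : SetPartitionC n) : ℕ :=
  ((P.arcs ×ˢ P.arcs).filter fun q => NestRel n q.1 q.2).card

/-- The number of crossings among pairs of arcs that both have positive opener. -/
def crossingsPos (P : SetPartitionC n) : ℕ :=
  (((P.arcs.filter fun p => 0 < p.1) ×ˢ (P.arcs.filter fun p => 0 < p.1)).filter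
    fun q => CrossRel n q.1 q.2).card

/-- The number of nestings among pairs of arcs that both have positive opener. -/
def nestingsPos (P : SetPartitionC n) : ℕ :=
  (((P.arcs.filter fun p => 0 < p.1) ×ˢ (P.arcs.filter fun p => 0 < p.1)).filter
    fun q => NestRel n q.1 q.2).card

/-- The cardinality of a maximal crossing. -/
def maxCrossing (P : SetPartitionC n) : ℕ :=
  (P.arcs.powerset.filter fun S => ∀ a ∈ S, ∀ b ∈ S, a ≠ b → Crosses n a b).sup Finset.card

/-- The cardinality of a maximal nesting. -/
def maxNesting (P : SetPartitionC n) : ℕ :=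
  (P.arcs.powerset.filter fun S => ∀ a ∈ S, ∀ b ∈ S, a ≠ b → Nests n a b).sup Finset.card

/-! ### Type B notions -/

/-- `(i,j)` is a type `B` nesting arc: consecutive elements of an augmented block in the
type `B` nesting order. -/
def IsArcB (P : SetPartitionC n) (i j : ℤ) : Prop :=
  nestOrdB n i < nestOrdB n j ∧ ∃ B ∈ P.blocks, i ∈ augB B ∧ j ∈ augB B ∧
    ∀ k ∈ augB B, ¬(nestOrdB n i < nestOrdB n k ∧ nestOrdB n k < nestOrdB n j)

/-- The finite set of type `B` nesting arcs of `P`. -/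
def arcsB (P : SetPartitionC n) : Finset (ℤ × ℤ) :=
  ((insert 0 (pmn n)) ×ˢ (insert 0 (pmn n))).filter fun p => P.IsArcB p.1 p.2

/-- The number of type `B` crossings. -/
def crossingsB (P : SetPartitionC n) : ℕ :=
  ((P.arcs ×ˢ P.arcs).filter fun q => CrossRel n q.1 q.2 ∧ ¬ExcCross q.1 q.2).card

/-- The number of type `B` nestings. -/
def nestingsB (P : SetPartitionC n) : ℕ :=
  ((P.arcsB ×ˢ P.arcsB).filter fun q => NestRelB n q.1 q.2 ∧ ¬ExcNest q.1 q.2).card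

/-- Openers in type `B`: positive elements not maximal in their block
w.r.t. the type `B` nesting order. -/
def openersB (P : SetPartitionC n) : Finset ℤ :=
  (Finset.Icc 1 (n : ℤ)).filter fun i =>
    ∃ B ∈ P.blocks, i ∈ B ∧ ∃ j ∈ B, nestOrdB n i < nestOrdB n j

/-- Closers in type `B`: positive elements not minimal in their block
w.r.t. the type `B` nesting order. -/
def closersB (P : SetPartitionC n) : Finset ℤ :=
  (Finset.Icc 1 (n : ℤ)).filter fun i =>
    ∃ B ∈ P.blocks, i ∈ B ∧ ∃ j ∈ B, nestOrdB n j < nestOrdB n i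

/-- The cardinality of a maximal type `B` crossing. -/
def maxCrossingB (P : SetPartitionC n) : ℕ :=
  (P.arcs.powerset.filter fun S =>
    ∀ a ∈ S, ∀ b ∈ S, a ≠ b → Crosses n a b ∧ ¬ExcCross a b).sup Finset.card

/-- The cardinality of a maximal type `B` nesting. -/
def maxNestingB (P : SetPartitionC n) : ℕ :=
  (P.arcsB.powerset.filter fun S =>
    ∀ a ∈ S, ∀ b ∈ S, a ≠ b → NestsB n a b ∧ ¬ExcNest a b).sup Finset.card

/-! ### Type D notions -/

/-- A type `C` set partition is of type `D` if the zero block, when present, is not a single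
pair `{i,-i}`. -/
def IsTypeD (P : SetPartitionC n) : Prop :=
  ∀ B ∈ P.blocks, negSet B = B → B.card ≠ 2

/-- The arcs starting in `{1,…,n-1}` and ending in the negative of an element of `{1,…,n-1}`. -/
def pnArcs (P : SetPartitionC n) : Finset (ℤ × ℤ) :=
  P.arcs.filter fun p => 0 < p.1 ∧ p.1 < (n : ℤ) ∧ -(n : ℤ) < p.2 ∧ p.2 < 0

/-- The index `l` of an arc `a = (i_l, -j_l)` in the list of `pnArcs` ordered by openers. -/
def dRank (P : SetPartitionC n) (a : ℤ × ℤ) : ℕ :=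
  (P.pnArcs.filter fun b => b.1 ≤ a.1).card

/-- The crossings allowed in a non-crossing set partition of type `D`. -/
def AllowedCrossD (P : SetPartitionC n) (p q : ℤ × ℤ) : Prop :=
  (ContainsN n p ∧ q ∈ P.pnArcs ∧ P.pnArcs.card < 2 * P.dRank q) ∨
  (ContainsN n q ∧ p ∈ P.pnArcs ∧ P.pnArcs.card < 2 * P.dRank p) ∨
  (ContainsNegN n p ∧ q ∈ P.pnArcs ∧ 2 * P.dRank q ≤ P.pnArcs.card) ∨
  (ContainsNegN n q ∧ p ∈ P.pnArcs ∧ 2 * P.dRank p ≤ P.pnArcs.card) ∨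
  (ContainsN n p ∧ ContainsNegN n q) ∨
  (ContainsN n q ∧ ContainsNegN n p)

/-- `P` is a non-crossing set partition of type `D_n`. -/
def NonCrossingD (P : SetPartitionC n) : Prop :=
  (∀ i : ℤ, 0 < i → P.IsArc i (-i) → i = n) ∧
  (∀ p ∈ P.arcs, ∀ q ∈ P.arcs, Crosses n p q → P.AllowedCrossD p q) ∧
  (∀ p ∈ P.arcs, ContainsN n p →
    ∀ q ∈ P.pnArcs, P.pnArcs.card < 2 * P.dRank q → Crosses n p q) ∧
  (∀ p ∈ P.arcs, ContainsNegN n p →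
    ∀ q ∈ P.pnArcs, 2 * P.dRank q ≤ P.pnArcs.card → Crosses n p q)

/-- The nestings (`p` over `q`) allowed in a non-nesting set partition of type `D`. -/
def AllowedNestD (P : SetPartitionC n) (p q : ℤ × ℤ) : Prop :=
  (0 < p.1 ∧ p.1 < q.1 ∧ q.1 < (n : ℤ) ∧ p.2 = -(n : ℤ) ∧ q.2 = (n : ℤ)) ∨
  (q.1 = (n : ℤ) ∧ q.2 = -(n : ℤ) ∧ 0 < p.1 ∧ p.1 < (n : ℤ) ∧ -(n : ℤ) < p.2 ∧ p.2 < 0 ∧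
    ∃ m : ℤ, 0 < m ∧ m < p.1 ∧ m < -p.2 ∧ P.IsArc m (n : ℤ))

/-- `P` is a non-nesting set partition of type `D_n`. -/
def NonNestingD (P : SetPartitionC n) : Prop :=
  (∀ i : ℤ, 0 < i → P.IsArc i (-i) → i = n) ∧
  (∀ p ∈ P.arcs, ∀ q ∈ P.arcs, NestRel n p q → P.AllowedNestD p q)

end SetPartitionC

/-! ### The staircase polyomino and chains in fillings -/

/-- The cells of the staircase polyomino `P_n`: `(c,r)` with `1 ≤ c ≤ n`, `c ≤ r ≤ 2n-1`. -/
def cellsP (n : ℕ) : Finset (ℕ × ℕ) :=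
  ((Finset.Icc 1 n) ×ˢ (Finset.Icc 1 (2 * n - 1))).filter fun p => p.1 ≤ p.2

/-- The length of the longest north-east chain among a set of (nonzero) cells:
columns strictly increase while rows strictly decrease. -/
def neLen (S : Finset (ℕ × ℕ)) : ℕ :=
  (S.powerset.filter fun T =>
    ∀ a ∈ T, ∀ b ∈ T, a ≠ b →
      (a.1 < b.1 ∧ b.2 < a.2) ∨ (b.1 < a.1 ∧ a.2 < b.2)).sup Finset.card

/-- The length of the longest south-east chain among a set of (nonzero) cells:
columns and rows strictly increase, and the surrounding rectangle lies in the polyomino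
(`a.1 ≤ b.2` for all cells `a`, `b` of the chain). -/
def seLen (S : Finset (ℕ × ℕ)) : ℕ :=
  (S.powerset.filter fun T =>
    (∀ a ∈ T, ∀ b ∈ T, a ≠ b →
      (a.1 < b.1 ∧ a.2 < b.2) ∨ (b.1 < a.1 ∧ b.2 < a.2)) ∧
    ∀ a ∈ T, ∀ b ∈ T, a.1 ≤ b.2).sup Finset.card

namespace SetPartitionC

variable {n : ℕ}

/-- The cells filled with `1` in the nesting filling of the staircase polyomino: rows are
labelled from top to bottom by `2,…,n,-n,…,-1`; the cell in column `i` and row labelled `j`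
is filled iff `(i,j)` is an arc with positive opener `i`. -/
def nestFill (P : SetPartitionC n) : Finset (ℕ × ℕ) :=
  (cellsP n).filter fun c => ∃ j : ℤ, P.IsArc (c.1 : ℤ) j ∧ nestOrd n j = (c.2 : ℤ) + 1

/-- The cells filled with `1` in the crossing filling of the staircase polyomino: rows are
labelled from top to bottom by `2,…,n,-1,…,-n`; the cell in column `i` and row labelled `j`
is filled iff `(i,j)` is an arc with positive opener `i`. -/
def crossFill (P : SetPartitionC n) : Finset (ℕ × ℕ) :=
  (cellsP n).filter fun c => ∃ j : ℤ, P.IsArc (c.1 : ℤ) j ∧ crossOrd n j = (c.2 : ℤ) + 1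

end SetPartitionC

/-! ### Triangulations of the symmetric 2n-gon and symmetric fans of Dyck paths -/

/-- `p` is a diagonal of the `2n`-gon with vertices labelled by `[±n]`, written with its two
(distinct) endpoints in crossing order. -/
def IsDiag (n : ℕ) (p : ℤ × ℤ) : Prop :=
  p.1 ≠ 0 ∧ p.2 ≠ 0 ∧ |p.1| ≤ (n : ℤ) ∧ |p.2| ≤ (n : ℤ) ∧ crossOrd n p.1 < crossOrd n p.2

/-- Normalize a pair so that its endpoints are in crossing order. -/
def normD (n : ℕ) (p : ℤ × ℤ) : ℤ × ℤ :=
  if crossOrd n p.1 < crossOrd n p.2 then p else (p.2, p.1)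

/-- `ω` contains `m` mutually crossing diagonals. -/
def HasMCross (n m : ℕ) (ω : Finset (ℤ × ℤ)) : Prop :=
  ∃ S ⊆ ω, S.card = m ∧ ∀ a ∈ S, ∀ b ∈ S, a ≠ b → Crosses n a b

/-- A type `C_n` `k`-triangulation: a symmetric set of diagonals with no `(k+1)`-crossing,
maximal with this property. -/
def IsTriangC (n k : ℕ) (ω : Finset (ℤ × ℤ)) : Prop :=
  (∀ p ∈ ω, IsDiag n p) ∧
  (∀ p ∈ ω, normD n (-p.1, -p.2) ∈ ω) ∧
  ¬HasMCross n (k + 1) ω ∧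
  ∀ d : ℤ × ℤ, IsDiag n d → d ∉ ω → HasMCross n (k + 1) (insert d ω)

/-- A Dyck path in the staircase polyomino starting at the top cell `(i,i)` of column `i`,
proceeding by unit south or west steps inside `P_n`, and ending on the main diagonal
`r = 2n - c`. -/
def IsDyckPath (n i : ℕ) (l : List (ℕ × ℕ)) : Prop :=
  l ≠ [] ∧ l.head? = some (i, i) ∧ (∀ c ∈ l, c ∈ cellsP n) ∧
  l.Chain' (fun a b => (b.1 = a.1 ∧ b.2 = a.2 + 1) ∨ (b.1 + 1 = a.1 ∧ b.2 = a.2)) ∧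
  ∀ c : ℕ × ℕ, l.getLast? = some c → c.2 = 2 * n - c.1

/-- A symmetric fan of `k` non-intersecting Dyck paths: the `i`-th path starts at cell
`(i,i)` and the paths are pairwise cell-disjoint. -/
def IsSymFan (n k : ℕ) (f : Fin k → List (ℕ × ℕ)) : Prop :=
  (∀ i : Fin k, IsDyckPath n ((i : ℕ) + 1) (f i)) ∧
  ∀ i j : Fin k, i ≠ j → ∀ c ∈ f i, c ∉ f j


namespace SetPartitionC

variable {n : ℕ}

theorem nestOrd_inj' {x y : ℤ} (hx : x ≠ 0 ∧ |x| ≤ (n : ℤ)) (hy : y ≠ 0 ∧ |y| ≤ (n : ℤ))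
    (h : nestOrd n x = nestOrd n y) : x = y := by
  have h1 := abs_le.1 hx.2
  have h2 := abs_le.1 hy.2
  unfold nestOrd at h
  split_ifs at h <;> omega

theorem nestOrd_neg' {x : ℤ} (hx : x ≠ 0) : nestOrd n (-x) = 2 * n + 1 - nestOrd n x := by
  unfold nestOrd
  split_ifs <;> omega

/-- Membership in the same block. -/
def SameB (P : SetPartitionC n) (x y : ℤ) : Prop := ∃ B ∈ P.blocks, x ∈ B ∧ y ∈ B

theorem block_eq (P : SetPartitionC n) {B B' : Finset ℤ} {x : ℤ} (hB : B ∈ P.blocks)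
    (hB' : B' ∈ P.blocks) (hx : x ∈ B) (hx' : x ∈ B') : B = B' := by
  by_contra h
  exact Finset.disjoint_left.1 (P.disj B hB B' hB' h) hx hx'

theorem mem_range (P : SetPartitionC n) {B : Finset ℤ} {x : ℤ} (hB : B ∈ P.blocks)
    (hx : x ∈ B) : x ≠ 0 ∧ |x| ≤ (n : ℤ) := (P.cover x).1 ⟨B, hB, hx⟩

theorem isArc_range (P : SetPartitionC n) {x y : ℤ} (h : P.IsArc x y) :
    (x ≠ 0 ∧ |x| ≤ (n : ℤ)) ∧ (y ≠ 0 ∧ |y| ≤ (n : ℤ)) := by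
  obtain ⟨_, B, hB, hx, hy, _⟩ := h
  exact ⟨P.mem_range hB hx, P.mem_range hB hy⟩

theorem isArc_right (P : SetPartitionC n) {x y z : ℤ} (h : P.IsArc x y) (h' : P.IsArc x z) :
    y = z := by
  obtain ⟨h1, B, hB, hx, hy, hc⟩ := h
  obtain ⟨h1', B', hB', hx', hy', hc'⟩ := h'
  obtain rfl := P.block_eq hB hB' hx hx'
  have a := hc _ hy'
  have b := hc' _ hy
  exact nestOrd_inj' (P.mem_range hB hy) (P.mem_range hB hy') (by omega)

theorem isArc_left (P : SetPartitionC n) {x y z : ℤ} (h : P.IsArc x z) (h' : P.IsArc y z) :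
    x = y := by
  obtain ⟨h1, B, hB, hx, hy, hc⟩ := h
  obtain ⟨h1', B', hB', hx', hy', hc'⟩ := h'
  obtain rfl := P.block_eq hB hB' hy hy'
  have a := hc _ hx'
  have b := hc' _ hx
  exact nestOrd_inj' (P.mem_range hB hx) (P.mem_range hB hx') (by omega)

theorem mem_negSet {B : Finset ℤ} {x : ℤ} : x ∈ negSet B ↔ -x ∈ B := by
  unfold negSet
  simp only [Finset.mem_image]
  constructor
  · rintro ⟨a, ha, rfl⟩; simpa using ha
  · intro h; exact ⟨-x, h, by simp⟩

theorem isArc_neg (P : SetPartitionC n) {x y : ℤ} (h : P.IsArc x y) : P.IsArc (-y) (-x) := by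
  have hr := P.isArc_range h
  obtain ⟨h1, B, hB, hx, hy, hc⟩ := h
  refine ⟨?_, negSet B, P.symm B hB, ?_, ?_, ?_⟩
  · rw [nestOrd_neg' hr.1.1, nestOrd_neg' hr.2.1]; omega
  · rw [mem_negSet]; simpa using hy
  · rw [mem_negSet]; simpa using hx
  · intro k hk
    rw [mem_negSet] at hk
    have := hc _ hk
    have hk0 := (P.mem_range hB hk).1
    rw [nestOrd_neg' (by simpa using hk0)] at this
    rw [nestOrd_neg' hr.1.1, nestOrd_neg' hr.2.1]; omega

theorem exists_next (P : SetPartitionC n) {B : Finset ℤ} {x y : ℤ} (hB : B ∈ P.blocks)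
    (hx : x ∈ B) (hy : y ∈ B) (h : nestOrd n x < nestOrd n y) :
    ∃ z ∈ B, P.IsArc x z ∧ nestOrd n z ≤ nestOrd n y := by
  obtain ⟨z, hz, hm⟩ := Finset.exists_min_image (B.filter fun z => nestOrd n x < nestOrd n z)
    (nestOrd n) ⟨y, by simp [hy, h]⟩
  simp only [Finset.mem_filter] at hz hm
  refine ⟨z, hz.1, ⟨hz.2, B, hB, hx, hz.1, ?_⟩, hm y ⟨hy, h⟩⟩
  rintro k hk ⟨h1, h2⟩
  have := hm k ⟨hk, h1⟩
  omega

theorem exists_prev (P : SetPartitionC n) {B : Finset ℤ} {x y : ℤ} (hB : B ∈ P.blocks)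
    (hx : x ∈ B) (hy : y ∈ B) (h : nestOrd n x < nestOrd n y) :
    ∃ z ∈ B, P.IsArc z y := by
  obtain ⟨z, hz, hm⟩ := Finset.exists_max_image (B.filter fun z => nestOrd n z < nestOrd n y)
    (nestOrd n) ⟨x, by simp [hx, h]⟩
  simp only [Finset.mem_filter] at hz hm
  refine ⟨z, hz.1, ⟨hz.2, B, hB, hz.1, hy, ?_⟩⟩
  rintro k hk ⟨h1, h2⟩
  have := hm k ⟨hk, h2⟩
  omega

theorem mem_openers_iff (P : SetPartitionC n) {x : ℤ} :
    x ∈ P.openers ↔ 0 < x ∧ ∃ y, P.IsArc x y := by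
  unfold openers
  simp only [Finset.mem_filter, Finset.mem_Icc]
  constructor
  · rintro ⟨h, B, hB, hx, j, hj, hlt⟩
    obtain ⟨z, _, hz, _⟩ := P.exists_next hB hx hj hlt
    exact ⟨by omega, z, hz⟩
  · rintro ⟨h, y, hy⟩
    have := abs_le.1 (P.isArc_range hy).1.2
    obtain ⟨h1, B, hB, hx, hy, hc⟩ := hy
    exact ⟨by omega, B, hB, hx, y, hy, h1⟩

theorem mem_closers_iff (P : SetPartitionC n) {x : ℤ} :
    x ∈ P.closers ↔ 0 < x ∧ ∃ y, P.IsArc y x := by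
  unfold closers
  simp only [Finset.mem_filter, Finset.mem_Icc]
  constructor
  · rintro ⟨h, B, hB, hx, j, hj, hlt⟩
    obtain ⟨z, _, hz⟩ := P.exists_prev hB hj hx hlt
    exact ⟨by omega, z, hz⟩
  · rintro ⟨h, y, hy⟩
    have := abs_le.1 (P.isArc_range hy).2.2
    obtain ⟨h1, B, hB, hx, hy, hc⟩ := hy
    exact ⟨by omega, B, hB, hy, y, hx, h1⟩

theorem mem_arcs_iff (P : SetPartitionC n) {p : ℤ × ℤ} : p ∈ P.arcs ↔ P.IsArc p.1 p.2 := by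
  unfold arcs pmn
  simp only [Finset.mem_filter, Finset.mem_product, Finset.mem_erase, Finset.mem_Icc]
  constructor
  · exact fun h => h.2
  · intro h
    have := P.isArc_range h
    have h1 := abs_le.1 this.1.2
    have h2 := abs_le.1 this.2.2
    exact ⟨⟨⟨this.1.1, h1⟩, ⟨this.2.1, h2⟩⟩, h⟩

theorem sameB_rtg (P : SetPartitionC n) {B : Finset ℤ} (hB : B ∈ P.blocks) {y : ℤ} (hy : y ∈ B) :
    ∀ (d : ℕ) (x : ℤ), x ∈ B → nestOrd n x ≤ nestOrd n y → nestOrd n y - nestOrd n x ≤ d →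
      Relation.ReflTransGen P.IsArc x y := by
  intro d
  induction d with
  | zero =>
    intro x hx h1 h2
    obtain rfl := nestOrd_inj' (P.mem_range hB hx) (P.mem_range hB hy) (by push_cast at h2; omega)
    exact .refl
  | succ d ih =>
    intro x hx h1 h2
    rcases h1.eq_or_lt with h | h
    · obtain rfl := nestOrd_inj' (P.mem_range hB hx) (P.mem_range hB hy) h
      exact .refl
    · obtain ⟨z, hz, ha, hle⟩ := P.exists_next hB hx hy h
      have := ha.1
      exact .head ha (ih z hz hle (by push_cast at h2; omega))

theorem sameB_iff (P : SetPartitionC n) {x y : ℤ} (hx : x ≠ 0 ∧ |x| ≤ (n : ℤ)) :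
    P.SameB x y ↔ Relation.ReflTransGen P.IsArc x y ∨ Relation.ReflTransGen P.IsArc y x := by
  have key : ∀ {a b : ℤ}, (a ≠ 0 ∧ |a| ≤ (n : ℤ)) → Relation.ReflTransGen P.IsArc a b →
      P.SameB a b := by
    intro a b ha h
    induction h with
    | refl => obtain ⟨B, hB, h⟩ := (P.cover a).2 ha; exact ⟨B, hB, h, h⟩
    | tail _ h1 ih =>
      obtain ⟨B, hB, h, h'⟩ := ih
      obtain ⟨_, B', hB', h2, h3, _⟩ := h1
      obtain rfl := P.block_eq hB hB' h' h2
      exact ⟨B, hB, h, h3⟩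
  constructor
  · rintro ⟨B, hB, h1, h2⟩
    rcases le_total (nestOrd n x) (nestOrd n y) with h | h
    · exact .inl (P.sameB_rtg hB h2 (nestOrd n y - nestOrd n x).toNat x h1 h (by omega))
    · exact .inr (P.sameB_rtg hB h1 (nestOrd n x - nestOrd n y).toNat y h2 h (by omega))
  · rintro (h | h)
    · exact key hx h
    · have : y ≠ 0 ∧ |y| ≤ (n : ℤ) := by
        rcases Relation.ReflTransGen.cases_head h with h | ⟨c, h, _⟩
        · rwa [h]
        · exact (P.isArc_range h).1
      obtain ⟨B, hB, h1, h2⟩ := key this h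
      exact ⟨B, hB, h2, h1⟩

theorem blocks_sub {P Q : SetPartitionC n} (h : ∀ x y, P.SameB x y ↔ Q.SameB x y) :
    P.blocks ⊆ Q.blocks := by
  intro B hB
  obtain ⟨x, hx⟩ := P.nonempty B hB
  obtain ⟨B', hB', hx', _⟩ := (h x x).1 ⟨B, hB, hx, hx⟩
  have : B = B' := by
    ext y
    constructor
    · intro hy
      obtain ⟨B'', hB'', h1, h2⟩ := (h x y).1 ⟨B, hB, hx, hy⟩
      rwa [Q.block_eq hB' hB'' hx' h1]
    · intro hy
      obtain ⟨B'', hB'', h1, h2⟩ := (h x y).2 ⟨B', hB', hx', hy⟩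
      rwa [P.block_eq hB hB'' hx h1]
  rwa [this]

theorem ext_blocks {P Q : SetPartitionC n} (h : P.blocks = Q.blocks) : P = Q := by
  cases P; cases Q; congr

theorem ext_arcs {P Q : SetPartitionC n}
    (h1 : ∀ a b : ℤ, 0 < a → 0 < b → (P.IsArc a b ↔ Q.IsArc a b))
    (h2 : ∀ a b : ℤ, 0 < a → 0 < b → (P.IsArc a (-b) ↔ Q.IsArc a (-b))) : P = Q := by
  have key : ∀ {P Q : SetPartitionC n},
    (∀ a b : ℤ, 0 < a → 0 < b → (P.IsArc a b ↔ Q.IsArc a b)) →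
    (∀ a b : ℤ, 0 < a → 0 < b → (P.IsArc a (-b) ↔ Q.IsArc a (-b))) →
    ∀ x y, P.IsArc x y → Q.IsArc x y := by
    intro P Q h1 h2 x y h
    have hr := P.isArc_range h
    rcases lt_or_gt_of_ne hr.1.1 with hx | hx <;> rcases lt_or_gt_of_ne hr.2.1 with hy | hy
    · have := Q.isArc_neg ((h1 (-y) (-x) (by omega) (by omega)).1 (P.isArc_neg h))
      simpa using this
    · exfalso
      have h1 := h.1
      have := abs_le.1 hr.1.2
      have := abs_le.1 hr.2.2
      unfold nestOrd at h1
      split_ifs at h1 <;> omega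
    · have := (h2 x (-y) hx (by omega)).1 (by simpa using h)
      simpa using this
    · exact (h1 x y hx hy).1 h
  have harc : P.IsArc = Q.IsArc := by
    funext x y
    exact propext ⟨key h1 h2 x y,
      key (fun a b ha hb => (h1 a b ha hb).symm) (fun a b ha hb => (h2 a b ha hb).symm) x y⟩
  have hs : ∀ x y, P.SameB x y ↔ Q.SameB x y := by
    intro x y
    by_cases hx : x ≠ 0 ∧ |x| ≤ (n : ℤ)
    · rw [P.sameB_iff hx, Q.sameB_iff hx, harc]
    · constructor
      · rintro ⟨B, hB, h, _⟩; exact absurd (P.mem_range hB h) hx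
      · rintro ⟨B, hB, h, _⟩; exact absurd (Q.mem_range hB h) hx
  exact ext_blocks (Finset.Subset.antisymm (blocks_sub hs) (blocks_sub fun x y => (hs x y).symm))

theorem zero_arc (P : SetPartitionC n) {B : Finset ℤ} (hB : B ∈ P.blocks) (h : negSet B = B) :
    ∃ i ∈ B, 0 < i ∧ P.IsArc i (-i) := by
  have hneg : ∀ x ∈ B, -x ∈ B := by
    intro x hx; rw [← h, mem_negSet]; simpa using hx
  obtain ⟨x, hx⟩ := P.nonempty B hB
  have hpos : ∃ x ∈ B, 0 < x := by
    rcases lt_or_gt_of_ne (P.mem_range hB hx).1 with h | h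
    · exact ⟨-x, hneg x hx, by omega⟩
    · exact ⟨x, hx, h⟩
  obtain ⟨x, hx, hx0⟩ := hpos
  obtain ⟨i, hi, hm⟩ := Finset.exists_max_image (B.filter fun z => 0 < z) id
    ⟨x, by simp [hx, hx0]⟩
  simp only [Finset.mem_filter, id] at hi hm
  refine ⟨i, hi.1, hi.2, ?_, B, hB, hi.1, hneg i hi.1, ?_⟩
  · have := abs_le.1 (P.mem_range hB hi.1).2
    unfold nestOrd
    split_ifs <;> omega
  · intro k hk
    have hr := abs_le.1 (P.mem_range hB hk).2
    have hk0 := (P.mem_range hB hk).1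
    have hi' := abs_le.1 (P.mem_range hB hi.1).2
    have a1 : 0 < k → k ≤ i := fun h => hm k ⟨hk, h⟩
    have a2 : k < 0 → -k ≤ i := fun h => hm (-k) ⟨hneg k hk, by omega⟩
    unfold nestOrd
    split_ifs <;> omega

end SetPartitionC

/-- The full arc relation obtained from the positive arcs `A` and the mixed arcs `S`. -/
def TRel (A S : ℤ → ℤ → Prop) (x y : ℤ) : Prop :=
  (0 < x ∧ 0 < y ∧ A x y) ∨ (x < 0 ∧ y < 0 ∧ A (-y) (-x)) ∨ (0 < x ∧ y < 0 ∧ S x (-y))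

structure HalfArcs (n : ℕ) (A S : ℤ → ℤ → Prop) : Prop where
  hA : ∀ a b, A a b → 1 ≤ a ∧ a < b ∧ b ≤ (n : ℤ)
  hS : ∀ i j, S i j → 1 ≤ i ∧ i ≤ (n : ℤ)
  sS : ∀ i j, S i j → S j i
  rA : ∀ a b c, A a b → A a c → b = c
  lA : ∀ a b c, A a c → A b c → a = b
  rS : ∀ a b c, S a b → S a c → b = c
  AS : ∀ a b c, A a b → S a c → False
  zS : ∀ i j, S i i → S j j → i = j

namespace HalfArcs

variable {n : ℕ} {A S : ℤ → ℤ → Prop}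

theorem range (H : HalfArcs n A S) {x y : ℤ} (h : TRel A S x y) :
    (x ≠ 0 ∧ |x| ≤ (n : ℤ)) ∧ (y ≠ 0 ∧ |y| ≤ (n : ℤ)) := by
  rw [abs_le, abs_le]
  rcases h with ⟨h1, h2, h⟩ | ⟨h1, h2, h⟩ | ⟨h1, h2, h⟩
  · have := H.hA _ _ h; omega
  · have := H.hA _ _ h; omega
  · have := H.hS _ _ h; have := H.hS _ _ (H.sS _ _ h); omega

theorem lt (H : HalfArcs n A S) {x y : ℤ} (h : TRel A S x y) : nestOrd n x < nestOrd n y := by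
  have := H.range h
  rw [abs_le, abs_le] at this
  rcases h with ⟨h1, h2, h⟩ | ⟨h1, h2, h⟩ | ⟨h1, h2, h⟩
  · have := H.hA _ _ h; unfold nestOrd; split_ifs <;> omega
  · have := H.hA _ _ h; unfold nestOrd; split_ifs <;> omega
  · unfold nestOrd; split_ifs <;> omega

theorem neg (H : HalfArcs n A S) {x y : ℤ} (h : TRel A S x y) : TRel A S (-y) (-x) := by
  rcases h with ⟨h1, h2, h⟩ | ⟨h1, h2, h⟩ | ⟨h1, h2, h⟩
  · exact .inr (.inl ⟨by omega, by omega, by simpa using h⟩)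
  · exact .inl ⟨by omega, by omega, by simpa using h⟩
  · exact .inr (.inr ⟨by omega, by omega, by simpa using H.sS _ _ h⟩)

theorem right (H : HalfArcs n A S) : Relator.RightUnique (TRel A S) := by
  intro x y z h h'
  rcases h with ⟨h1, h2, h⟩ | ⟨h1, h2, h⟩ | ⟨h1, h2, h⟩ <;>
    rcases h' with ⟨h1', h2', h'⟩ | ⟨h1', h2', h'⟩ | ⟨h1', h2', h'⟩ <;> try omega
  · exact H.rA _ _ _ h h'
  · exact (H.AS _ _ _ h h').elim
  · have := H.lA _ _ _ h h'; omega
  · exact (H.AS _ _ _ h' h).elim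
  · have := H.rS _ _ _ h h'; omega

theorem left (H : HalfArcs n A S) : Relator.RightUnique (Function.swap (TRel A S)) := by
  intro x y z h h'
  have := H.right (H.neg h) (H.neg h')
  omega

theorem rtg_le (H : HalfArcs n A S) {x y : ℤ} (h : Relation.ReflTransGen (TRel A S) x y) :
    nestOrd n x ≤ nestOrd n y := by
  induction h with
  | refl => rfl
  | tail _ h ih => have := H.lt h; omega

theorem rtg_neg (H : HalfArcs n A S) {x y : ℤ} (h : Relation.ReflTransGen (TRel A S) x y) :
    Relation.ReflTransGen (TRel A S) (-y) (-x) := by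
  induction h with
  | refl => exact .refl
  | tail _ h ih => exact .head (H.neg h) ih

/-- The equivalence relation generated by arcs. -/
def E (A S : ℤ → ℤ → Prop) (x y : ℤ) : Prop :=
  Relation.ReflTransGen (TRel A S) x y ∨ Relation.ReflTransGen (TRel A S) y x

theorem E_symm {x y : ℤ} (h : E A S x y) : E A S y x := Or.symm h

theorem E_trans (H : HalfArcs n A S) {x y z : ℤ} (h : E A S x y) (h' : E A S y z) : E A S x z := by
  rcases h with h | h <;> rcases h' with h' | h'
  · exact .inl (h.trans h')
  · have a : Relation.ReflTransGen (Function.swap (TRel A S)) y x := Relation.reflTransGen_swap.2 h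
    have b : Relation.ReflTransGen (Function.swap (TRel A S)) y z := Relation.reflTransGen_swap.2 h'
    rcases Relation.ReflTransGen.total_of_right_unique H.left a b with c | c
    · exact .inr (Relation.reflTransGen_swap.1 c)
    · exact .inl (Relation.reflTransGen_swap.1 c)
  · exact Relation.ReflTransGen.total_of_right_unique H.right h h'
  · exact .inr (h'.trans h)

theorem E_neg (H : HalfArcs n A S) {x y : ℤ} (h : E A S x y) : E A S (-x) (-y) := by
  rcases h with h | h
  · exact .inr (H.rtg_neg h)
  · exact .inl (H.rtg_neg h)

/-- Block of `x`. -/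
def blk (n : ℕ) (A S : ℤ → ℤ → Prop) (x : ℤ) : Finset ℤ :=
  (SetPartitionC.pmn n).filter fun y => E A S x y

theorem mem_pmn {x : ℤ} : x ∈ SetPartitionC.pmn n ↔ x ≠ 0 ∧ |x| ≤ (n : ℤ) := by
  unfold SetPartitionC.pmn
  simp [abs_le]

theorem mem_blk {x y : ℤ} : y ∈ blk n A S x ↔ (y ≠ 0 ∧ |y| ≤ (n : ℤ)) ∧ E A S x y := by
  unfold blk
  rw [Finset.mem_filter, mem_pmn]

theorem blk_eq (H : HalfArcs n A S) {x y : ℤ} (h : E A S x y) : blk n A S x = blk n A S y := by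
  ext z
  rw [mem_blk, mem_blk]
  exact and_congr_right fun _ => ⟨fun h' => H.E_trans (E_symm h) h', fun h' => H.E_trans h h'⟩

theorem blk_neg (H : HalfArcs n A S) {x : ℤ} : negSet (blk n A S x) = blk n A S (-x) := by
  ext z
  rw [SetPartitionC.mem_negSet, mem_blk, mem_blk]
  refine and_congr (by simp) ⟨fun h => ?_, fun h => ?_⟩
  · simpa using H.E_neg h
  · simpa using H.E_neg h

theorem arc_iff (H : HalfArcs n A S) {x y w : ℤ} (hx : x ∈ blk n A S w) (hy : y ∈ blk n A S w) :
    (nestOrd n x < nestOrd n y ∧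
      ∀ k ∈ blk n A S w, ¬(nestOrd n x < nestOrd n k ∧ nestOrd n k < nestOrd n y)) ↔
      TRel A S x y := by
  rw [mem_blk] at hx hy
  constructor
  · rintro ⟨h, hc⟩
    have hE := H.E_trans (E_symm hx.2) hy.2
    rcases hE with hE | hE
    · rcases Relation.ReflTransGen.cases_head hE with rfl | ⟨c, h1, h2⟩
      · omega
      · have l1 := H.lt h1
        have l2 := H.rtg_le h2
        have := hc c (mem_blk.2 ⟨(H.range h1).2, H.E_trans hx.2 (.inl (.single h1))⟩)
        have : c = y := SetPartitionC.nestOrd_inj' (H.range h1).2 hy.1 (by omega)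
        rwa [← this]
    · have := H.rtg_le hE; omega
  · intro h
    refine ⟨H.lt h, ?_⟩
    rintro k hk ⟨h1, h2⟩
    rw [mem_blk] at hk
    have hE := H.E_trans (E_symm hx.2) hk.2
    rcases hE with hE | hE
    · rcases Relation.ReflTransGen.cases_head hE with rfl | ⟨c, h3, h4⟩
      · omega
      · obtain rfl := H.right h h3
        have := H.rtg_le h4
        omega
    · have := H.rtg_le hE; omega

theorem exists_partition (H : HalfArcs n A S) :
    ∃ P : SetPartitionC n, ∀ x y, P.IsArc x y ↔ TRel A S x y := by
  have hmem : ∀ {B : Finset ℤ}, B ∈ (SetPartitionC.pmn n).image (blk n A S) ↔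
      ∃ x, (x ≠ 0 ∧ |x| ≤ (n : ℤ)) ∧ blk n A S x = B := by
    intro B
    simp only [Finset.mem_image, mem_pmn]
  have hself : ∀ {x : ℤ}, (x ≠ 0 ∧ |x| ≤ (n : ℤ)) → x ∈ blk n A S x := fun h =>
    mem_blk.2 ⟨h, .inl .refl⟩
  have harc : ∀ x y, (nestOrd n x < nestOrd n y ∧
      ∃ B ∈ (SetPartitionC.pmn n).image (blk n A S), x ∈ B ∧ y ∈ B ∧
      ∀ k ∈ B, ¬(nestOrd n x < nestOrd n k ∧ nestOrd n k < nestOrd n y)) ↔ TRel A S x y := by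
    intro x y
    constructor
    · rintro ⟨h, B, hB, hx, hy, hc⟩
      obtain ⟨w, hw, rfl⟩ := hmem.1 hB
      exact (H.arc_iff hx hy).1 ⟨h, hc⟩
    · intro h
      have hr := H.range h
      have hy : y ∈ blk n A S x := mem_blk.2 ⟨hr.2, .inl (.single h)⟩
      obtain ⟨h1, h2⟩ := (H.arc_iff (hself hr.1) hy).2 h
      exact ⟨h1, _, hmem.2 ⟨x, hr.1, rfl⟩, hself hr.1, hy, h2⟩
  have hdisj : ∀ B ∈ (SetPartitionC.pmn n).image (blk n A S),
      ∀ B' ∈ (SetPartitionC.pmn n).image (blk n A S), ∀ x, x ∈ B → x ∈ B' → B = B' := by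
    intro B hB B' hB' x hx hx'
    obtain ⟨w, hw, rfl⟩ := hmem.1 hB
    obtain ⟨w', hw', rfl⟩ := hmem.1 hB'
    exact H.blk_eq (H.E_trans (mem_blk.1 hx).2 (E_symm (mem_blk.1 hx').2))
  have hz : ∀ B ∈ (SetPartitionC.pmn n).image (blk n A S), negSet B = B →
      ∃ i ∈ B, S i i := by
    intro B hB h
    have hneg : ∀ x ∈ B, -x ∈ B := by
      intro x hx; rw [← h, SetPartitionC.mem_negSet]; simpa using hx
    obtain ⟨w, hw, rfl⟩ := hmem.1 hB
    have hrange : ∀ x ∈ blk n A S w, x ≠ 0 ∧ |x| ≤ (n : ℤ) := fun x hx => (mem_blk.1 hx).1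
    have hpos : ∃ x ∈ blk n A S w, 0 < x := by
      rcases lt_or_gt_of_ne hw.1 with h | h
      · exact ⟨-w, hneg w (hself hw), by omega⟩
      · exact ⟨w, hself hw, h⟩
    obtain ⟨x, hx, hx0⟩ := hpos
    obtain ⟨i, hi, hm⟩ := Finset.exists_max_image ((blk n A S w).filter fun z => 0 < z) id
      ⟨x, by simp [hx, hx0]⟩
    simp only [Finset.mem_filter, id] at hi hm
    have hT : TRel A S i (-i) := by
      rw [← H.arc_iff hi.1 (hneg i hi.1)]
      constructor
      · have := abs_le.1 (hrange _ hi.1).2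
        unfold nestOrd
        split_ifs <;> omega
      · intro k hk
        have hr := abs_le.1 (hrange _ hk).2
        have hk0 := (hrange _ hk).1
        have hi' := abs_le.1 (hrange _ hi.1).2
        have a1 : 0 < k → k ≤ i := fun h => hm k ⟨hk, h⟩
        have a2 : k < 0 → -k ≤ i := fun h => hm (-k) ⟨hneg k hk, by omega⟩
        unfold nestOrd
        split_ifs <;> omega
    refine ⟨i, hi.1, ?_⟩
    rcases hT with ⟨h1, h2, h⟩ | ⟨h1, h2, h⟩ | ⟨h1, h2, h⟩
    · omega
    · omega
    · simpa using h
  refine ⟨{ blocks := (SetPartitionC.pmn n).image (blk n A S)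
            nonempty := ?_, disj := ?_, cover := ?_, symm := ?_, zeroBlock := ?_ }, harc⟩
  · intro B hB
    obtain ⟨w, hw, rfl⟩ := hmem.1 hB
    exact ⟨w, hself hw⟩
  · intro B hB B' hB' hne
    rw [Finset.disjoint_left]
    exact fun x hx hx' => hne (hdisj B hB B' hB' x hx hx')
  · intro i
    constructor
    · rintro ⟨B, hB, hi⟩
      obtain ⟨w, hw, rfl⟩ := hmem.1 hB
      exact (mem_blk.1 hi).1
    · intro hi
      exact ⟨_, hmem.2 ⟨i, hi, rfl⟩, hself hi⟩
  · intro B hB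
    obtain ⟨w, hw, rfl⟩ := hmem.1 hB
    rw [H.blk_neg]
    exact hmem.2 ⟨-w, by simpa using hw, rfl⟩
  · intro B hB B' hB' h h'
    obtain ⟨i, hi, hS⟩ := hz B hB h
    obtain ⟨j, hj, hS'⟩ := hz B' hB' h'
    obtain rfl := H.zS _ _ hS hS'
    exact hdisj B hB B' hB' i hi hj

end HalfArcs

/-- The rank of `x` with respect to `R`. -/
def rk (R : Finset ℤ) (x : ℤ) : ℕ := (R.filter fun y => y ≤ x).card

theorem rk_mono (R : Finset ℤ) {x y : ℤ} (h : x ≤ y) : rk R x ≤ rk R y := by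
  apply Finset.card_le_card
  intro z
  simp only [Finset.mem_filter]
  exact fun hz => ⟨hz.1, hz.2.trans h⟩

theorem rk_lt {R : Finset ℤ} {x y : ℤ} (hy : y ∈ R) (h : x < y) : rk R x < rk R y := by
  apply Finset.card_lt_card
  rw [Finset.ssubset_iff_of_subset]
  · exact ⟨y, by simp [hy], by simp [h]⟩
  · intro z
    simp only [Finset.mem_filter]
    exact fun hz => ⟨hz.1, hz.2.trans h.le⟩

theorem rk_le_iff {R : Finset ℤ} {x y : ℤ} (hy : y ∈ R) : y ≤ x ↔ rk R y ≤ rk R x := by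
  constructor
  · exact fun h => rk_mono R h
  · intro h
    by_contra h'
    have := rk_lt hy (not_le.1 h')
    omega

theorem rk_pos {R : Finset ℤ} {x : ℤ} (hx : x ∈ R) : 1 ≤ rk R x :=
  Finset.card_pos.2 ⟨x, by simp [hx]⟩

theorem rk_le_card (R : Finset ℤ) (x : ℤ) : rk R x ≤ R.card := Finset.card_filter_le _ _

theorem rk_inj {R : Finset ℤ} {x y : ℤ} (hx : x ∈ R) (hy : y ∈ R) (h : rk R x = rk R y) :
    x = y :=
  le_antisymm ((rk_le_iff hx).2 h.le) ((rk_le_iff hy).2 h.ge)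

theorem exists_rk {R : Finset ℤ} {t : ℕ} (h1 : 1 ≤ t) (h2 : t ≤ R.card) :
    ∃ x ∈ R, rk R x = t := by
  have hsub : R.image (rk R) ⊆ Finset.Icc 1 R.card := by
    intro t ht
    obtain ⟨x, hx, rfl⟩ := Finset.mem_image.1 ht
    exact Finset.mem_Icc.2 ⟨rk_pos hx, rk_le_card R x⟩
  have hcard : (R.image (rk R)).card = R.card :=
    Finset.card_image_of_injOn fun x hx y hy h => rk_inj hx hy h
  have heq := Finset.eq_of_subset_of_card_le hsub (by simp [hcard])
  have : t ∈ R.image (rk R) := by rw [heq]; exact Finset.mem_Icc.2 ⟨h1, h2⟩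
  obtain ⟨x, hx, h⟩ := Finset.mem_image.1 this
  exact ⟨x, hx, h⟩

theorem rk_anti {R : Finset ℤ} {σ : ℤ → ℤ} (h1 : ∀ i ∈ R, σ i ∈ R) (h2 : ∀ i ∈ R, σ (σ i) = i)
    (h3 : ∀ i ∈ R, ∀ j ∈ R, i < j → σ j < σ i) {i : ℤ} (hi : i ∈ R) :
    rk R i + rk R (σ i) = R.card + 1 := by
  have e1 : rk R (σ i) = (R.filter fun y => i ≤ y).card := by
    symm
    apply Finset.card_bij (fun y _ => σ y)
    · intro y hy
      simp only [Finset.mem_filter] at hy ⊢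
      refine ⟨h1 y hy.1, ?_⟩
      rcases hy.2.eq_or_lt with h | h
      · rw [h]
      · exact (h3 _ hi _ hy.1 h).le
    · intro y hy z hz h
      simp only [Finset.mem_filter] at hy hz
      rw [← h2 y hy.1, ← h2 z hz.1, h]
    · intro y hy
      simp only [Finset.mem_filter] at hy
      refine ⟨σ y, ?_, h2 y hy.1⟩
      simp only [Finset.mem_filter]
      refine ⟨h1 y hy.1, ?_⟩
      by_contra h
      have := h3 _ (h1 y hy.1) _ hi (not_le.1 h)
      rw [h2 y hy.1] at this
      omega
  have e2 : (R.filter fun y => y < i).card + (R.filter fun y => ¬ y < i).card = R.card :=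
    Finset.card_filter_add_card_filter_not _
  have e3 : (R.filter fun y => i ≤ y) = (R.filter fun y => ¬ y < i) := by
    ext y; simp
  have e4 : rk R i = (R.filter fun y => y < i).card + 1 := by
    have : (R.filter fun y => y ≤ i) = insert i (R.filter fun y => y < i) := by
      ext y
      simp only [Finset.mem_filter, Finset.mem_insert]
      constructor
      · rintro ⟨a, b⟩
        rcases b.eq_or_lt with h | h
        · exact .inl h
        · exact .inr ⟨a, h⟩
      · rintro (rfl | ⟨a, b⟩)
        · exact ⟨hi, le_rfl⟩
        · exact ⟨a, b.le⟩
    unfold rk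
    rw [this, Finset.card_insert_of_notMem (by simp)]
  rw [e1, e3, e4]
  omega

theorem rk_erase {R : Finset ℤ} {m : ℤ} (hm : m ∈ R) (x : ℤ) :
    rk (R.erase m) x + (if m ≤ x then 1 else 0) = rk R x := by
  unfold rk
  rw [Finset.filter_erase]
  split_ifs with h
  · exact Finset.card_erase_add_one (by simp [hm, h])
  · rw [Finset.erase_eq_of_notMem (by simp [h])]; rfl

/-- The non-crossing ("stack") matching of closers with openers. -/
structure Stack (O C : Finset ℤ) (M : Finset (ℤ × ℤ)) : Prop where
  hO : ∀ a b, (a, b) ∈ M → a ∈ O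
  hC : ∀ a b, (a, b) ∈ M → b ∈ C
  lt : ∀ a b, (a, b) ∈ M → a < b
  cov : ∀ b ∈ C, ∃ a, (a, b) ∈ M
  r : ∀ a b c, (a, b) ∈ M → (a, c) ∈ M → b = c
  l : ∀ a b c, (a, c) ∈ M → (b, c) ∈ M → a = b
  nc : ∀ a b a' b', (a, b) ∈ M → (a', b') ∈ M → ¬(a < a' ∧ a' < b ∧ b < b')
  ns : ∀ i ∈ O, (∀ b, (i, b) ∉ M) → ∀ a b, (a, b) ∈ M → ¬(a < i ∧ i < b)

namespace Stack

variable {O C : Finset ℤ} {M M' : Finset (ℤ × ℤ)}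

/-- The unmatched openers. -/
def rest (O : Finset ℤ) (M : Finset (ℤ × ℤ)) : Finset ℤ := O.filter fun i => ∀ b, (i, b) ∉ M

theorem card_rest (h : Stack O C M) : (rest O M).card + C.card = O.card := by
  have h1 : C.card = M.card := by
    symm
    apply Finset.card_bij (fun p _ => p.2)
    · exact fun p hp => h.hC p.1 p.2 hp
    · intro p hp q hq hpq
      have : p.1 = q.1 := h.l _ _ p.2 hp (by rw [hpq]; exact hq)
      exact Prod.ext this hpq
    · intro b hb
      obtain ⟨a, ha⟩ := h.cov b hb
      exact ⟨_, ha, rfl⟩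
  have h2 : (O.filter fun i => ¬ ∀ b, (i, b) ∉ M).card = M.card := by
    symm
    apply Finset.card_bij (fun p _ => p.1)
    · intro p hp
      simp only [Finset.mem_filter, not_forall, not_not]
      exact ⟨h.hO p.1 p.2 hp, p.2, hp⟩
    · intro p hp q hq hpq
      have : p.2 = q.2 := h.r p.1 _ _ hp (by rw [hpq]; exact hq)
      exact Prod.ext hpq this
    · intro a ha
      simp only [Finset.mem_filter, not_forall, not_not] at ha
      obtain ⟨b, hb⟩ := ha.2
      exact ⟨_, hb, rfl⟩
  rw [h1, ← h2]
  exact Finset.card_filter_add_card_filter_not _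

theorem uniq_aux (h : Stack O C M) (h' : Stack O C M') {b a a' : ℤ}
    (ih : ∀ c < b, ∀ x, (x, c) ∈ M → (x, c) ∈ M') (ha : (a, b) ∈ M) (ha' : (a', b) ∈ M') :
    a' ≤ a := by
  by_contra hlt
  have hlt := not_le.1 hlt
  have hb := h'.lt _ _ ha'
  by_cases hu : ∀ c, (a', c) ∉ M
  · exact h.ns a' (h'.hO _ _ ha') hu a b ha ⟨hlt, hb⟩
  · push Not at hu
    obtain ⟨c, hc⟩ := hu
    rcases lt_trichotomy c b with h1 | h1 | h1
    · have := h'.r _ _ _ (ih c h1 a' hc) ha'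
      omega
    · subst h1
      have := h.l _ _ _ ha hc
      omega
    · exact h.nc _ _ _ _ ha hc ⟨hlt, hb, h1⟩

theorem uniq (h : Stack O C M) (h' : Stack O C M') : M = M' := by
  have key : ∀ b ∈ C, ∀ a, (a, b) ∈ M ↔ (a, b) ∈ M' := by
    by_contra hne
    push Not at hne
    obtain ⟨b0, hb0, hbad0⟩ := hne
    obtain ⟨b, hb, hm⟩ := Finset.exists_min_image
      (C.filter fun b => ∃ a, ¬((a, b) ∈ M ↔ (a, b) ∈ M')) id
      ⟨b0, by
        simp only [Finset.mem_filter]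
        obtain ⟨a, ha⟩ := hbad0
        exact ⟨hb0, a, by tauto⟩⟩
    simp only [Finset.mem_filter, id] at hb hm
    have ih : ∀ c < b, ∀ x, (x, c) ∈ M ↔ (x, c) ∈ M' := by
      intro c hc x
      by_cases hcC : c ∈ C
      · by_contra hx
        have := hm c ⟨hcC, x, hx⟩
        omega
      · exact ⟨fun hx => absurd (h.hC _ _ hx) hcC, fun hx => absurd (h'.hC _ _ hx) hcC⟩
    obtain ⟨a, ha⟩ := h.cov b hb.1
    obtain ⟨a', ha'⟩ := h'.cov b hb.1
    have l1 := uniq_aux h h' (fun c hc x => (ih c hc x).1) ha ha'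
    have l2 := uniq_aux h' h (fun c hc x => (ih c hc x).2) ha' ha
    obtain rfl := le_antisymm l1 l2
    obtain ⟨x, hx⟩ := hb.2
    apply hx
    constructor
    · intro hx
      rwa [h.l _ _ _ hx ha]
    · intro hx
      rwa [h'.l _ _ _ hx ha']
  ext ⟨a, b⟩
  by_cases hb : b ∈ C
  · exact key b hb a
  · exact ⟨fun hx => absurd (h.hC _ _ hx) hb, fun hx => absurd (h'.hC _ _ hx) hb⟩

theorem exists_stack (n : ℕ) (O C : Finset ℤ)
    (hdom : ∀ k : ℕ, k < n →
      (C ∩ Finset.Icc 1 ((k : ℤ) + 1)).card ≤ (O ∩ Finset.Icc 1 (k : ℤ)).card) :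
    ∀ N : ℕ, N ≤ n → ∃ M, Stack (O ∩ Finset.Icc 1 (N : ℤ)) (C ∩ Finset.Icc 1 (N : ℤ)) M := by
  intro N
  induction N with
  | zero =>
    intro _
    refine ⟨∅, ?_⟩
    constructor <;> simp
  | succ N ih =>
    intro hN
    obtain ⟨M, hM⟩ := ih (by omega)
    have hmem : ∀ S : Finset ℤ, ∀ x, x ∈ S ∩ Finset.Icc 1 (((N + 1 : ℕ) : ℤ)) ↔
        x ∈ S ∩ Finset.Icc 1 (N : ℤ) ∨ (x ∈ S ∧ x = (N : ℤ) + 1) := by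
      intro S x
      simp only [Finset.mem_inter, Finset.mem_Icc]
      push_cast
      constructor
      · rintro ⟨a, b, c⟩
        rcases c.eq_or_lt with h | h
        · exact .inr ⟨a, h⟩
        · exact .inl ⟨a, b, by omega⟩
      · rintro (⟨a, b, c⟩ | ⟨a, b⟩)
        · exact ⟨a, b, by omega⟩
        · exact ⟨a, by omega, by omega⟩
    have hCle : ∀ a b, (a, b) ∈ M → b ≤ N := by
      intro a b hab
      have := hM.hC _ _ hab
      simp only [Finset.mem_inter, Finset.mem_Icc] at this
      exact this.2.2
    by_cases hc : ((N : ℤ) + 1) ∈ C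
    · have hd := hdom N (by omega)
      have hne : (rest (O ∩ Finset.Icc 1 (N : ℤ)) M).Nonempty := by
        rw [← Finset.card_pos]
        have h1 := hM.card_rest
        have h2 : (C ∩ Finset.Icc 1 (N : ℤ)).card < (C ∩ Finset.Icc 1 ((N : ℤ) + 1)).card := by
          apply Finset.card_lt_card
          rw [Finset.ssubset_iff_of_subset]
          · exact ⟨(N : ℤ) + 1, by simp [hc], by simp⟩
          · intro z
            simp only [Finset.mem_inter, Finset.mem_Icc]
            exact fun hz => ⟨hz.1, hz.2.1, by omega⟩
        omega
      obtain ⟨a, ha, hmax⟩ := Finset.exists_max_image _ id hne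
      simp only [rest, Finset.mem_filter, id] at ha hmax
      have haN : a ≤ N := by
        have := ha.1
        simp only [Finset.mem_inter, Finset.mem_Icc] at this
        exact this.2.2
      refine ⟨insert (a, (N : ℤ) + 1) M, ?_⟩
      have hin : ∀ x y, (x, y) ∈ insert (a, (N : ℤ) + 1) M ↔
          (x = a ∧ y = (N : ℤ) + 1) ∨ (x, y) ∈ M := by
        intro x y; simp
      constructor
      · intro x y hxy
        rw [hmem]
        rcases (hin _ _).1 hxy with ⟨rfl, rfl⟩ | h
        · exact .inl ha.1
        · exact .inl (hM.hO _ _ h)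
      · intro x y hxy
        rw [hmem]
        rcases (hin _ _).1 hxy with ⟨rfl, rfl⟩ | h
        · exact .inr ⟨hc, rfl⟩
        · exact .inl (hM.hC _ _ h)
      · intro x y hxy
        rcases (hin _ _).1 hxy with ⟨rfl, rfl⟩ | h
        · omega
        · exact hM.lt _ _ h
      · intro b hb
        rcases (hmem _ _).1 hb with h | ⟨_, rfl⟩
        · obtain ⟨x, hx⟩ := hM.cov b h
          exact ⟨x, (hin _ _).2 (.inr hx)⟩
        · exact ⟨a, (hin _ _).2 (.inl ⟨rfl, rfl⟩)⟩
      · intro x y z h1 h2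
        rcases (hin _ _).1 h1 with ⟨rfl, rfl⟩ | k1 <;> rcases (hin _ _).1 h2 with ⟨h3, rfl⟩ | h2
        · rfl
        · exact absurd h2 (ha.2 _)
        · subst h3; exact absurd k1 (ha.2 _)
        · exact hM.r _ _ _ k1 h2
      · intro x y z h1 h2
        rcases (hin _ _).1 h1 with ⟨rfl, rfl⟩ | h1 <;> rcases (hin _ _).1 h2 with ⟨h3, h4⟩ | h2
        · exact h3.symm
        · have := hCle _ _ h2; omega
        · have := hCle _ _ h1; omega
        · exact hM.l _ _ _ h1 h2
      · intro x y x' y' h1 h2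
        rcases (hin _ _).1 h1 with ⟨rfl, rfl⟩ | k1 <;> rcases (hin _ _).1 h2 with ⟨rfl, rfl⟩ | h2
        · omega
        · have := hCle _ _ h2; omega
        · rintro ⟨h3, h4, h5⟩
          exact hM.ns _ ha.1 ha.2 _ _ k1 ⟨h3, h4⟩
        · exact hM.nc _ _ _ _ k1 h2
      · intro i hi hun x y hxy
        have hun' : ∀ b, (i, b) ∉ M := fun b hb => hun b ((hin _ _).2 (.inr hb))
        rcases (hmem _ _).1 hi with h | ⟨_, rfl⟩
        · rcases (hin _ _).1 hxy with ⟨rfl, rfl⟩ | h1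
          · have := hmax i ⟨h, hun'⟩
            omega
          · exact hM.ns _ h hun' _ _ h1
        · rcases (hin _ _).1 hxy with ⟨rfl, rfl⟩ | h1
          · omega
          · have := hCle _ _ h1
            omega
    · refine ⟨M, ?_⟩
      have hC' : C ∩ Finset.Icc 1 (((N + 1 : ℕ) : ℤ)) = C ∩ Finset.Icc 1 (N : ℤ) := by
        ext x
        rw [hmem]
        constructor
        · rintro (h | ⟨h, rfl⟩)
          · exact h
          · exact absurd h hc
        · exact .inl
      rw [hC']
      refine ⟨fun a b h => (hmem _ _).2 (.inl (hM.hO a b h)), hM.hC, hM.lt, hM.cov, hM.r, hM.l,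
        hM.nc, ?_⟩
      intro i hi hun a b hab
      rcases (hmem _ _).1 hi with h | ⟨_, rfl⟩
      · exact hM.ns i h hun a b hab
      · have := hCle _ _ hab
        omega

end Stack

/-- The elements of `S` smaller than `n`. -/
def low (n : ℕ) (S : Finset ℤ) : Finset ℤ := S ∩ Finset.Icc 1 ((n - 1 : ℕ) : ℤ)

/-- Standing assumptions. -/
structure Ctx (n : ℕ) (O C : Finset ℤ) (M : Finset (ℤ × ℤ)) : Prop where
  n2 : 2 ≤ n
  hO : ∀ x ∈ O, 1 ≤ x ∧ x ≤ (n : ℤ)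
  hC : ∀ x ∈ C, 1 ≤ x ∧ x ≤ (n : ℤ)
  st : Stack (low n O) (low n C) M

/-- Free openers. -/
def free (n : ℕ) (O : Finset ℤ) (M : Finset (ℤ × ℤ)) : Finset ℤ := Stack.rest (low n O) M

/-- The free openers other than `m`, `j`. -/
def RR (R0 : Finset ℤ) (m j : ℤ) : Finset ℤ := (R0.erase m).erase j

structure Valid (n : ℕ) (O C R0 : Finset ℤ) (m j : ℤ) : Prop where
  mC : (n : ℤ) ∈ C → m ∈ R0
  mC' : (n : ℤ) ∉ C → m = 0
  jO : (n : ℤ) ∈ O → j ∈ R0 ∨ (j = n ∧ (n : ℤ) ∈ C)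
  jO' : (n : ℤ) ∉ O → j = 0
  ne : (n : ℤ) ∈ O → j ≠ m
  ev : Even (RR R0 m j).card
  mid_m : (n : ℤ) ∈ C → 2 * rk (RR R0 m j) m = (RR R0 m j).card
  mid_j : j ∈ R0 → 2 * rk (RR R0 m j) j = (RR R0 m j).card

def AA (n : ℕ) (C : Finset ℤ) (M : Finset (ℤ × ℤ)) (m : ℤ) (a b : ℤ) : Prop :=
  (a, b) ∈ M ∨ ((n : ℤ) ∈ C ∧ a = m ∧ b = n)

def SS (n : ℕ) (O R : Finset ℤ) (j : ℤ) (a b : ℤ) : Prop :=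
  (a ∈ R ∧ b ∈ R ∧ rk R a + rk R b = R.card + 1) ∨
    ((n : ℤ) ∈ O ∧ ((a = n ∧ b = j) ∨ (a = j ∧ b = n)))

theorem mem_low {n : ℕ} {S : Finset ℤ} {x : ℤ} (hn : 2 ≤ n) :
    x ∈ low n S ↔ x ∈ S ∧ 1 ≤ x ∧ x < (n : ℤ) := by
  unfold low
  simp only [Finset.mem_inter, Finset.mem_Icc]
  refine and_congr_right fun _ => and_congr_right fun _ => ?_
  omega

theorem mem_RR {R0 : Finset ℤ} {m j x : ℤ} : x ∈ RR R0 m j ↔ x ≠ j ∧ x ≠ m ∧ x ∈ R0 := by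
  unfold RR
  simp [Finset.mem_erase]

theorem crossOrd_pos {n : ℕ} {x : ℤ} (h : 0 < x) : crossOrd n x = x := if_pos h
theorem crossOrd_neg {n : ℕ} {x : ℤ} (h : x < 0) : crossOrd n x = n - x := if_neg (by omega)

theorem crosses_symm {n : ℕ} {p q : ℤ × ℤ} (h : Crosses n p q) : Crosses n q p := Or.symm h

theorem allowed_symm {n : ℕ} {P : SetPartitionC n} {p q : ℤ × ℤ} (h : P.AllowedCrossD p q) :
    P.AllowedCrossD q p := by
  rcases h with h | h | h | h | h | h
  · exact .inr (.inl h)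
  · exact .inl h
  · exact .inr (.inr (.inr (.inl h)))
  · exact .inr (.inr (.inl h))
  · exact .inr (.inr (.inr (.inr (.inr h))))
  · exact .inr (.inr (.inr (.inr (.inl h))))

theorem pn_card {n : ℕ} {P : SetPartitionC n} {R : Finset ℤ}
    (h1 : ∀ p ∈ P.pnArcs, p.1 ∈ R) (h2 : ∀ i ∈ R, ∃ p ∈ P.pnArcs, p.1 = i) :
    P.pnArcs.card = R.card ∧ ∀ a, P.dRank a = rk R a.1 := by
  have hinj : ∀ p ∈ P.pnArcs, ∀ q ∈ P.pnArcs, p.1 = q.1 → p = q := by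
    intro p hp q hq h
    have hp := P.mem_arcs_iff.1 (Finset.mem_filter.1 hp).1
    have hq := P.mem_arcs_iff.1 (Finset.mem_filter.1 hq).1
    rw [← h] at hq
    exact Prod.ext h (P.isArc_right hp hq)
  constructor
  · apply Finset.card_bij (fun p _ => p.1)
    · exact h1
    · exact hinj
    · intro i hi
      obtain ⟨p, hp, rfl⟩ := h2 i hi
      exact ⟨p, hp, rfl⟩
  · intro a
    unfold SetPartitionC.dRank rk
    apply Finset.card_bij (fun p _ => p.1)
    · intro p hp
      rw [Finset.mem_filter] at hp ⊢
      exact ⟨h1 p hp.1, hp.2⟩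
    · intro p hp q hq h
      exact hinj p (Finset.mem_filter.1 hp).1 q (Finset.mem_filter.1 hq).1 h
    · intro i hi
      rw [Finset.mem_filter] at hi
      obtain ⟨p, hp, rfl⟩ := h2 i hi.1
      exact ⟨p, Finset.mem_filter.2 ⟨hp, hi.2⟩, rfl⟩

namespace Ctx

variable {n : ℕ} {O C : Finset ℤ} {M : Finset (ℤ × ℤ)}

theorem M_b (X : Ctx n O C M) {a b : ℤ} (h : (a, b) ∈ M) :
    1 ≤ a ∧ a < b ∧ b < (n : ℤ) ∧ a ∈ O ∧ b ∈ C := by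
  have h1 := (mem_low X.n2).1 (X.st.hO _ _ h)
  have h2 := (mem_low X.n2).1 (X.st.hC _ _ h)
  exact ⟨h1.2.1, X.st.lt _ _ h, h2.2.2, h1.1, h2.1⟩

theorem mem_free (X : Ctx n O C M) {x : ℤ} :
    x ∈ free n O M ↔ x ∈ O ∧ 1 ≤ x ∧ x < (n : ℤ) ∧ ∀ b, (x, b) ∉ M := by
  unfold free Stack.rest
  rw [Finset.mem_filter, mem_low X.n2]
  tauto

theorem cov (X : Ctx n O C M) {b : ℤ} (h : b ∈ C) (hb : b < n) : ∃ a, (a, b) ∈ M :=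
  X.st.cov b ((mem_low X.n2).2 ⟨h, (X.hC b h).1, hb⟩)

theorem ns (X : Ctx n O C M) {x a b : ℤ} (h : x ∈ free n O M) (hab : (a, b) ∈ M) :
    ¬(a < x ∧ x < b) := by
  unfold free Stack.rest at h
  rw [Finset.mem_filter] at h
  exact X.st.ns x h.1 h.2 a b hab

theorem halfArcs (X : Ctx n O C M) {m j : ℤ} (V : Valid n O C (free n O M) m j) :
    HalfArcs n (AA n C M m) (SS n O (RR (free n O M) m j) j) := by
  have n2 := X.n2
  have hRb : ∀ x ∈ RR (free n O M) m j, 1 ≤ x ∧ x < (n : ℤ) ∧ (∀ b, (x, b) ∉ M) ∧ x ≠ j ∧ x ≠ m := by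
    intro x hx
    have h1 := mem_RR.1 hx
    have h2 := X.mem_free.1 h1.2.2
    exact ⟨h2.2.1, h2.2.2.1, h2.2.2.2, h1.1, h1.2.1⟩
  have hm : (n : ℤ) ∈ C → 1 ≤ m ∧ m < (n : ℤ) ∧ (∀ b, (m, b) ∉ M) := by
    intro h
    have h2 := X.mem_free.1 (V.mC h)
    exact ⟨h2.2.1, h2.2.2.1, h2.2.2.2⟩
  have hj : (n : ℤ) ∈ O → j ≠ m ∧ 1 ≤ j ∧ j ≤ (n : ℤ) ∧ (∀ b, (j, b) ∉ M) := by
    intro h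
    refine ⟨V.ne h, ?_⟩
    rcases V.jO h with h1 | ⟨rfl, h1⟩
    · have h2 := X.mem_free.1 h1
      exact ⟨h2.2.1, by omega, h2.2.2.2⟩
    · refine ⟨by omega, by omega, fun b hb => ?_⟩
      have := X.M_b hb
      omega
  have hev : ∀ i, rk (RR (free n O M) m j) i + rk (RR (free n O M) m j) i
      ≠ (RR (free n O M) m j).card + 1 := by
    intro i h
    obtain ⟨t, ht⟩ := V.ev
    omega
  constructor
  · rintro a b (h | ⟨h, rfl, rfl⟩)
    · have := X.M_b h; omega
    · have := hm h; omega
  · rintro a b (⟨h, h', _⟩ | ⟨h, ⟨rfl, rfl⟩ | ⟨rfl, rfl⟩⟩)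
    · have := hRb _ h; omega
    · omega
    · have := hj h; omega
  · rintro a b (⟨h, h', h''⟩ | ⟨h, h' | h'⟩)
    · exact .inl ⟨h', h, by omega⟩
    · exact .inr ⟨h, .inr ⟨h'.2, h'.1⟩⟩
    · exact .inr ⟨h, .inl ⟨h'.2, h'.1⟩⟩
  · rintro a b c (h | ⟨h, h1, h2⟩) (h' | ⟨h', h1', h2'⟩)
    · exact X.st.r _ _ _ h h'
    · subst h1'; exact absurd h ((hm h').2.2 _)
    · subst h1; exact absurd h' ((hm h).2.2 _)
    · omega
  · rintro a b c (h | ⟨h, h1, h2⟩) (h' | ⟨h', h1', h2'⟩)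
    · exact X.st.l _ _ _ h h'
    · have := X.M_b h; omega
    · have := X.M_b h'; omega
    · omega
  · rintro a b c (⟨h, h1, h2⟩ | ⟨h, h1⟩) (⟨h', h1', h2'⟩ | ⟨h', h1'⟩)
    · exact rk_inj h1 h1' (by omega)
    · have := hRb _ h; omega
    · have := hRb _ h'; omega
    · omega
  · rintro a b c (h | ⟨h, h1, h2⟩) (⟨h', h1', h2'⟩ | ⟨h', h1'⟩)
    · exact (hRb _ h').2.2.1 _ h
    · rcases h1' with h1' | h1'
      · have := X.M_b h; omega
      · rw [h1'.1] at h; exact (hj h').2.2.2 _ h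
    · exact (hRb _ h').2.2.2.2 h1
    · have := hj h'
      have := hm h
      omega
  · rintro a b (⟨h, h1, h2⟩ | ⟨h, h1⟩) (⟨h', h1', h2'⟩ | ⟨h', h1'⟩)
    · exact (hev _ h2).elim
    · exact (hev _ h2).elim
    · exact (hev _ h2').elim
    · omega

end Ctx

namespace Ctx

variable {n : ℕ} {O C : Finset ℤ} {M : Finset (ℤ × ℤ)}

theorem seven (X : Ctx n O C M) {m j : ℤ} (V : Valid n O C (free n O M) m j) {R : Finset ℤ}
    (hR : R = RR (free n O M) m j) {x y : ℤ}
    (h : TRel (AA n C M m) (SS n O R j) x y) :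
    ((x, y) ∈ M ∧ 1 ≤ x ∧ x < y ∧ y < n ∧ crossOrd n x = x ∧ crossOrd n y = y) ∨
    ((n : ℤ) ∈ C ∧ x = m ∧ y = n ∧ 1 ≤ m ∧ m < n ∧ m ∈ free n O M ∧
      crossOrd n x = x ∧ crossOrd n y = y) ∨
    ((-y, -x) ∈ M ∧ y ≤ -1 ∧ x < y ∧ -n < x ∧ crossOrd n x = n - x ∧ crossOrd n y = n - y) ∨
    ((n : ℤ) ∈ C ∧ x = -n ∧ y = -m ∧ 1 ≤ m ∧ m < n ∧ m ∈ free n O M ∧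
      crossOrd n x = n - x ∧ crossOrd n y = n - y) ∨
    ((x ∈ R ∧ -y ∈ R ∧ rk R x + rk R (-y) = R.card + 1) ∧ 1 ≤ x ∧ x < n ∧ y ≤ -1 ∧ -n < y ∧
      x ∈ free n O M ∧ -y ∈ free n O M ∧ crossOrd n x = x ∧ crossOrd n y = n - y) ∨
    (x = n ∧ y = -j ∧ 1 ≤ j ∧ j ≤ n ∧ (j ≠ n → j ∈ free n O M) ∧
      crossOrd n x = x ∧ crossOrd n y = n - y) ∨
    (x = j ∧ y = -n ∧ 1 ≤ j ∧ j ≤ n ∧ (j ≠ n → j ∈ free n O M) ∧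
      crossOrd n x = x ∧ crossOrd n y = n - y) := by
  subst hR
  have n2 := X.n2
  have hm : (n : ℤ) ∈ C → 1 ≤ m ∧ m < (n : ℤ) ∧ m ∈ free n O M := by
    intro h
    have h2 := X.mem_free.1 (V.mC h)
    exact ⟨h2.2.1, h2.2.2.1, V.mC h⟩
  have hj : (n : ℤ) ∈ O → 1 ≤ j ∧ j ≤ (n : ℤ) ∧ (j ≠ n → j ∈ free n O M) := by
    intro h
    rcases V.jO h with h1 | ⟨rfl, h1⟩
    · have h2 := X.mem_free.1 h1
      exact ⟨h2.2.1, by omega, fun _ => h1⟩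
    · exact ⟨by omega, by omega, fun h => absurd rfl h⟩
  rcases h with ⟨h1, h2, h⟩ | ⟨h1, h2, h⟩ | ⟨h1, h2, h⟩
  · rcases h with h | ⟨h, hx, hy⟩
    · have := X.M_b h
      exact .inl ⟨h, by omega, by omega, by omega, crossOrd_pos h1, crossOrd_pos h2⟩
    · have := hm h
      exact .inr (.inl ⟨h, hx, hy, this.1, this.2.1, this.2.2, crossOrd_pos h1, crossOrd_pos h2⟩)
  · rcases h with h | ⟨h, hx, hy⟩
    · have := X.M_b h
      exact .inr (.inr (.inl ⟨h, by omega, by omega, by omega, crossOrd_neg h1, crossOrd_neg h2⟩))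
    · have := hm h
      exact .inr (.inr (.inr (.inl ⟨h, by omega, by omega, this.1, this.2.1, this.2.2,
        crossOrd_neg h1, crossOrd_neg h2⟩)))
  · rcases h with h | ⟨h, h3 | h3⟩
    · have a := (mem_RR.1 h.1).2.2
      have b := (mem_RR.1 h.2.1).2.2
      have a' := X.mem_free.1 a
      have b' := X.mem_free.1 b
      exact .inr (.inr (.inr (.inr (.inl ⟨h, by omega, by omega, by omega, by omega, a, b,
        crossOrd_pos h1, crossOrd_neg h2⟩))))
    · have := hj h
      exact .inr (.inr (.inr (.inr (.inr (.inl ⟨by omega, by omega, this.1, this.2.1, this.2.2,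
        crossOrd_pos h1, crossOrd_neg h2⟩)))))
    · have := hj h
      exact .inr (.inr (.inr (.inr (.inr (.inr ⟨by omega, by omega, this.1, this.2.1, this.2.2,
        crossOrd_pos h1, crossOrd_neg h2⟩)))))

theorem mid_fact (X : Ctx n O C M) {m j : ℤ} (V : Valid n O C (free n O M) m j) {R : Finset ℤ}
    (hR : R = RR (free n O M) m j) {i : ℤ} (hi : i ∈ R) :
    ((n : ℤ) ∈ C → (i < m ∧ 2 * rk R i ≤ R.card) ∨ (m < i ∧ R.card < 2 * rk R i)) ∧
    (j ∈ free n O M → (i < j ∧ 2 * rk R i ≤ R.card) ∨ (j < i ∧ R.card < 2 * rk R i)) := by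
  subst hR
  have h := mem_RR.1 hi
  constructor
  · intro hn
    have h1 := V.mid_m hn
    have h2 := rk_le_iff (x := m) hi
    omega
  · intro hn
    have h1 := V.mid_j hn
    have h2 := rk_le_iff (x := j) hi
    omega

set_option maxHeartbeats 4000000 in
theorem exists_good (X : Ctx n O C M) {m j : ℤ} (V : Valid n O C (free n O M) m j) :
    ∃ P : SetPartitionC n, (P.IsTypeD ∧ P.NonCrossingD ∧ P.openers = O ∧ P.closers = C) ∧
      ∀ x y, P.IsArc x y ↔ TRel (AA n C M m) (SS n O (RR (free n O M) m j) j) x y := by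
  have n2 := X.n2
  have H := X.halfArcs V
  obtain ⟨R, hR⟩ : ∃ R, R = RR (free n O M) m j := ⟨_, rfl⟩
  rw [← hR] at H ⊢
  obtain ⟨P, hP⟩ := H.exists_partition
  refine ⟨P, ?_, hP⟩
  have hRb : ∀ x ∈ R, 1 ≤ x ∧ x < (n : ℤ) := by
    intro x hx
    rw [hR] at hx
    have h2 := X.mem_free.1 (mem_RR.1 hx).2.2
    exact ⟨h2.2.1, h2.2.2.1⟩
  have hRpart : ∀ x ∈ R, ∃ y ∈ R, rk R x + rk R y = R.card + 1 := by
    intro x hx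
    have h1 := rk_pos hx
    have h2 := rk_le_card R x
    obtain ⟨y, hy, h⟩ := exists_rk (R := R) (t := R.card + 1 - rk R x) (by omega) (by omega)
    exact ⟨y, hy, by omega⟩
  have hpn : ∀ p, p ∈ P.pnArcs ↔ (p.1 ∈ R ∧ -p.2 ∈ R ∧ rk R p.1 + rk R (-p.2) = R.card + 1) := by
    intro p
    unfold SetPartitionC.pnArcs
    rw [Finset.mem_filter, P.mem_arcs_iff, hP]
    constructor
    · rintro ⟨h, h1, h2, h3, h4⟩
      rcases X.seven V hR h with k | k | k | k | k | k | k
      · omega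
      · omega
      · omega
      · omega
      · exact k.1
      · omega
      · omega
    · intro h
      have h1 := hRb _ h.1
      have h2 := hRb _ h.2.1
      exact ⟨.inr (.inr ⟨by omega, by omega, .inl h⟩), by omega, by omega, by omega, by omega⟩
  obtain ⟨hcard, hrank⟩ := pn_card (P := P) (R := R) (fun p hp => ((hpn p).1 hp).1) (by
    intro i hi
    obtain ⟨y, hy, h⟩ := hRpart i hi
    exact ⟨(i, -y), (hpn _).2 ⟨hi, by simpa using hy, by simpa using h⟩, rfl⟩)
  obtain ⟨tev, hev⟩ := V.ev
  rw [← hR] at hev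
  refine ⟨?_, ⟨?_, ?_, ?_, ?_⟩, ?_, ?_⟩
  · intro B hB hz hc
    obtain ⟨i, hi, hi0, harc⟩ := P.zero_arc hB hz
    have hni : -i ∈ B := by rw [← hz, SetPartitionC.mem_negSet]; simpa using hi
    have hT := (hP _ _).1 harc
    have hB2 : B = {i, -i} := by
      symm
      apply Finset.eq_of_subset_of_card_le
      · intro z hz
        simp only [Finset.mem_insert, Finset.mem_singleton] at hz
        rcases hz with rfl | rfl <;> assumption
      · rw [hc, Finset.card_pair (by omega)]
    have hin : i = n ∧ j = n := by
      rcases X.seven V hR hT with k | k | k | k | k | k | k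
      · omega
      · omega
      · omega
      · omega
      · have := k.1.2.2
        simp only [neg_neg] at this
        obtain ⟨t, ht⟩ := V.ev
        rw [← hR] at ht
        omega
      · omega
      · omega
    have hnO : (n : ℤ) ∈ O := by
      by_contra h
      have := V.jO' h
      omega
    have hnC : (n : ℤ) ∈ C := by
      rcases V.jO hnO with h | h
      · have := X.mem_free.1 h
        omega
      · exact h.2
    have hm := X.mem_free.1 (V.mC hnC)
    have harc2 : P.IsArc m n := (hP _ _).2 (.inl ⟨by omega, by omega, .inr ⟨hnC, rfl, rfl⟩⟩)
    obtain ⟨_, B', hB', h1, h2, _⟩ := harc2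
    rw [hin.1] at hi
    obtain rfl := P.block_eq hB hB' hi h2
    rw [hB2] at h1
    simp only [Finset.mem_insert, Finset.mem_singleton] at h1
    omega
  · intro i hi0 harc
    rcases X.seven V hR ((hP _ _).1 harc) with k | k | k | k | k | k | k
    · omega
    · omega
    · omega
    · omega
    · have := k.1.2.2
      simp only [neg_neg] at this
      obtain ⟨t, ht⟩ := V.ev
      rw [← hR] at ht
      omega
    · omega
    · omega
  · rintro ⟨x, y⟩ hp ⟨x', y'⟩ hq hc
    rw [P.mem_arcs_iff, hP] at hp hq
    have al1 : ∀ p q : ℤ × ℤ, q ∈ P.pnArcs → ContainsN n p → R.card < 2 * rk R q.1 →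
        P.AllowedCrossD p q := fun p q h1 h2 h3 => .inl ⟨h2, h1, by rw [hcard, hrank]; exact h3⟩
    have al2 : ∀ p q : ℤ × ℤ, q ∈ P.pnArcs → ContainsNegN n p → 2 * rk R q.1 ≤ R.card →
        P.AllowedCrossD p q :=
      fun p q h1 h2 h3 => .inr (.inr (.inl ⟨h2, h1, by rw [hcard, hrank]; exact h3⟩))
    have al3 : ∀ p q : ℤ × ℤ, ContainsN n p → ContainsNegN n q → P.AllowedCrossD p q :=
      fun p q h1 h2 => .inr (.inr (.inr (.inr (.inl ⟨h1, h2⟩))))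
    have five : ∀ x y x' y' : ℤ, x' ∈ R → -y' ∈ R → rk R x' + rk R (-y') = R.card + 1 →
        ContainsN n (x, y) → ContainsNegN n (x, y) → P.AllowedCrossD (x, y) (x', y') := by
      intro x y x' y' h1 h2 h3 h4 h5
      by_cases h : R.card < 2 * rk R x'
      · exact al1 _ _ ((hpn _).2 ⟨h1, h2, h3⟩) h4 h
      · exact al2 _ _ ((hpn _).2 ⟨h1, h2, h3⟩) h5 (not_lt.1 h)
    have key : ∀ x y x' y' : ℤ, TRel (AA n C M m) (SS n O R j) x y →
        TRel (AA n C M m) (SS n O R j) x' y' → Crosses n (x, y) (x', y') →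
        (x' ∈ R → -y' ∈ R → 1 ≤ x' → y' ≤ -1 → False) →
        P.AllowedCrossD (x, y) (x', y') := by
      intro x y x' y' hp hq hc h5
      simp only [Crosses, CrossRel, cpr] at hc
      rcases X.seven V hR hp with
        ⟨hM, k1, k2, k3, e1, e2⟩ | ⟨hnC, k1, k2, k3, k4, hf, e1, e2⟩ |
        ⟨hM, k1, k2, k3, e1, e2⟩ | ⟨hnC, k1, k2, k3, k4, hf, e1, e2⟩ |
        ⟨⟨hr, hr2, hr3⟩, k1, k2, k3, k4, hf, hf2, e1, e2⟩ |
        ⟨k1, k2, k3, k4, hf, e1, e2⟩ | ⟨k1, k2, k3, k4, hf, e1, e2⟩ <;>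
      rcases X.seven V hR hq with
        ⟨hM', k1', k2', k3', e1', e2'⟩ | ⟨hnC', k1', k2', k3', k4', hf', e1', e2'⟩ |
        ⟨hM', k1', k2', k3', e1', e2'⟩ | ⟨hnC', k1', k2', k3', k4', hf', e1', e2'⟩ |
        ⟨⟨hr', hr2', hr3'⟩, k1', k2', k3', k4', hf', hf2', e1', e2'⟩ |
        ⟨k1', k2', k3', k4', hf', e1', e2'⟩ | ⟨k1', k2', k3', k4', hf', e1', e2'⟩ <;>
      rw [e1, e2, e1', e2'] at hc <;>
      first
      | exact (h5 hr' hr2' k1' k3').elim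
      | (exfalso; omega)
      | exact al3 _ _ (by show x = n ∨ y = n; omega) (by show x' = -n ∨ y' = -n; omega)
      | exact allowed_symm (al3 _ _ (by show x' = n ∨ y' = n; omega) (by show x = -n ∨ y = -n; omega))
      | (exfalso
         have f1 := X.st.nc _ _ _ _ hM hM'
         have f2 := X.st.nc _ _ _ _ hM' hM
         omega)
      | (exfalso; have f1 := X.ns hf hM'; have f2 := X.ns hf2 hM'; omega)
      | (exfalso; have f1 := X.ns hf hM'; omega)
      | (exfalso; have f1 := X.ns hf' hM; omega)
      | (exfalso
         have f1 := X.ns (hf (by omega)) hM'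
         omega)
      | (exfalso
         have f1 := X.ns (hf' (by omega)) hM
         omega)
      | (have f1 := (X.mid_fact V hR hr).1 hnC'
         have f2 := (X.mid_fact V hR hr2).1 hnC'
         first
         | exact allowed_symm (al1 _ _ ((hpn _).2 ⟨hr, hr2, hr3⟩)
             (by show x' = n ∨ y' = n; omega) (by show _ < 2 * rk R x; omega))
         | exact allowed_symm (al2 _ _ ((hpn _).2 ⟨hr, hr2, hr3⟩)
             (by show x' = -n ∨ y' = -n; omega) (by show 2 * rk R x ≤ _; omega)))
      | (by_cases hjn : j = n
         · exact allowed_symm (five _ _ _ _ hr hr2 hr3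
             (by show x' = n ∨ y' = n; omega) (by show x' = -n ∨ y' = -n; omega))
         · have f1 := (X.mid_fact V hR hr).2 (hf' hjn)
           have f2 := (X.mid_fact V hR hr2).2 (hf' hjn)
           first
           | exact allowed_symm (al1 _ _ ((hpn _).2 ⟨hr, hr2, hr3⟩)
               (by show x' = n ∨ y' = n; omega) (by show _ < 2 * rk R x; omega))
           | exact allowed_symm (al2 _ _ ((hpn _).2 ⟨hr, hr2, hr3⟩)
               (by show x' = -n ∨ y' = -n; omega) (by show 2 * rk R x ≤ _; omega)))
    by_cases h5' : x' ∈ R ∧ -y' ∈ R ∧ 1 ≤ x' ∧ y' ≤ -1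
    · by_cases h5 : x ∈ R ∧ -y ∈ R ∧ 1 ≤ x ∧ y ≤ -1
      · exfalso
        have g : ∀ x y : ℤ, x ∈ R → -y ∈ R → 1 ≤ x → y ≤ -1 →
            TRel (AA n C M m) (SS n O R j) x y → rk R x + rk R (-y) = R.card + 1 := by
          intro x y h1 h2 h3 h4 h
          have b1 := hRb _ h1
          have b2 := hRb _ h2
          rcases X.seven V hR h with k | k | k | k | k | k | k
          · omega
          · omega
          · omega
          · omega
          · exact k.1.2.2
          · omega
          · omega
        have r1 := g x y h5.1 h5.2.1 h5.2.2.1 h5.2.2.2 hp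
        have r2 := g x' y' h5'.1 h5'.2.1 h5'.2.2.1 h5'.2.2.2 hq
        have s1 := rk_le_iff (x := x') h5.1
        have s2 := rk_le_iff (x := x) h5'.1
        have s3 := rk_le_iff (x := -y') h5.2.1
        have s4 := rk_le_iff (x := -y) h5'.2.1
        have b1 := hRb _ h5.1
        have b2 := hRb _ h5'.1
        simp only [Crosses, CrossRel, cpr] at hc
        rw [crossOrd_pos (by omega : 0 < x), crossOrd_pos (by omega : 0 < x'),
          crossOrd_neg (by omega : y < 0), crossOrd_neg (by omega : y' < 0)] at hc
        omega
      · exact allowed_symm (key _ _ _ _ hq hp (crosses_symm hc)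
          (fun a b c d => h5 ⟨a, b, c, d⟩))
    · exact key _ _ _ _ hp hq hc (fun a b c d => h5' ⟨a, b, c, d⟩)
  · rintro ⟨x, y⟩ hp hN ⟨x', y'⟩ hq hlt
    rw [P.mem_arcs_iff, hP] at hp
    rw [hcard, hrank] at hlt
    obtain ⟨h1, h2, h3⟩ := (hpn _).1 hq
    have b1 := hRb _ h1
    have b2 := hRb _ h2
    change x = n ∨ y = n at hN
    dsimp only at *
    simp only [Crosses, CrossRel, cpr]
    rw [crossOrd_pos (by omega : 0 < x'), crossOrd_neg (by omega : y' < 0)]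
    have mx := X.mid_fact V hR h1
    have my := X.mid_fact V hR h2
    rcases X.seven V hR hp with k | k | k | k | k | k | k
    · omega
    · have := mx.1 k.1
      have := my.1 k.1
      rw [k.2.2.2.2.2.2.1, k.2.2.2.2.2.2.2]
      omega
    · omega
    · omega
    · omega
    · rw [k.2.2.2.2.2.1, k.2.2.2.2.2.2]
      by_cases hjn : j = n
      · omega
      · have := mx.2 (k.2.2.2.2.1 hjn)
        have := my.2 (k.2.2.2.2.1 hjn)
        omega
    · rw [k.2.2.2.2.2.1, k.2.2.2.2.2.2]
      omega
  · rintro ⟨x, y⟩ hp hN ⟨x', y'⟩ hq hlt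
    rw [P.mem_arcs_iff, hP] at hp
    rw [hcard, hrank] at hlt
    obtain ⟨h1, h2, h3⟩ := (hpn _).1 hq
    have b1 := hRb _ h1
    have b2 := hRb _ h2
    change x = -n ∨ y = -n at hN
    dsimp only at *
    simp only [Crosses, CrossRel, cpr]
    rw [crossOrd_pos (by omega : 0 < x'), crossOrd_neg (by omega : y' < 0)]
    have mx := X.mid_fact V hR h1
    have my := X.mid_fact V hR h2
    rcases X.seven V hR hp with k | k | k | k | k | k | k
    · omega
    · omega
    · omega
    · have := mx.1 k.1
      have := my.1 k.1
      rw [k.2.2.2.2.2.2.1, k.2.2.2.2.2.2.2]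
      omega
    · omega
    · rw [k.2.2.2.2.2.1, k.2.2.2.2.2.2]
      omega
    · rw [k.2.2.2.2.2.1, k.2.2.2.2.2.2]
      by_cases hjn : j = n
      · omega
      · have := mx.2 (k.2.2.2.2.1 hjn)
        have := my.2 (k.2.2.2.2.1 hjn)
        omega
  · ext x
    rw [P.mem_openers_iff]
    constructor
    · rintro ⟨hx, y, hy⟩
      rcases (hP _ _).1 hy with ⟨h1, h2, h⟩ | ⟨h1, h2, h⟩ | ⟨h1, h2, h⟩
      · rcases h with h | ⟨h, rfl, _⟩
        · exact (X.M_b h).2.2.2.1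
        · exact (X.mem_free.1 (V.mC h)).1
      · omega
      · rcases h with h | ⟨h, ⟨rfl, _⟩ | ⟨rfl, _⟩⟩
        · have := h.1
          rw [hR, mem_RR, X.mem_free] at this
          exact this.2.2.1
        · exact h
        · rcases V.jO h with h1 | ⟨h1, _⟩
          · exact (X.mem_free.1 h1).1
          · rw [h1]; exact h
    · intro hx
      have hb := X.hO x hx
      refine ⟨by omega, ?_⟩
      simp only [hP]
      by_cases hxn : x = n
      · rw [hxn] at hx
        have : 0 < j := by
          rcases V.jO hx with h1 | ⟨h1, _⟩
          · have := X.mem_free.1 h1; omega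
          · omega
        exact ⟨-j, .inr (.inr ⟨by omega, by omega, .inr ⟨hx, .inl ⟨hxn, by simp⟩⟩⟩)⟩
      · by_cases hM : ∀ b, (x, b) ∉ M
        · have hfree : x ∈ free n O M := X.mem_free.2 ⟨hx, hb.1, by omega, hM⟩
          by_cases hxm : x = m
          · have hnC : (n : ℤ) ∈ C := by
              by_contra h
              have := V.mC' h
              omega
            exact ⟨n, .inl ⟨by omega, by omega, .inr ⟨hnC, hxm, rfl⟩⟩⟩
          · by_cases hxj : x = j
            · have hnO : (n : ℤ) ∈ O := by
                by_contra h
                have := V.jO' h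
                omega
              exact ⟨-n, .inr (.inr ⟨by omega, by omega, .inr ⟨hnO, .inr ⟨hxj, by simp⟩⟩⟩)⟩
            · have hxR : x ∈ R := by rw [hR, mem_RR]; exact ⟨hxj, hxm, hfree⟩
              obtain ⟨y, hy, h⟩ := hRpart x hxR
              have := hRb y hy
              exact ⟨-y, .inr (.inr ⟨by omega, by omega,
                .inl ⟨hxR, by simpa using hy, by simpa using h⟩⟩)⟩
        · push Not at hM
          obtain ⟨b, hb⟩ := hM
          have := X.M_b hb
          exact ⟨b, .inl ⟨by omega, by omega, .inl hb⟩⟩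
  · ext x
    rw [P.mem_closers_iff]
    constructor
    · rintro ⟨hx, y, hy⟩
      rcases (hP _ _).1 hy with ⟨h1, h2, h⟩ | ⟨h1, h2, h⟩ | ⟨h1, h2, h⟩
      · rcases h with h | ⟨h, _, rfl⟩
        · exact (X.M_b h).2.2.2.2
        · exact h
      · omega
      · omega
    · intro hx
      have hb := X.hC x hx
      refine ⟨by omega, ?_⟩
      simp only [hP]
      by_cases hxn : x = n
      · rw [hxn] at hx
        have := X.mem_free.1 (V.mC hx)
        exact ⟨m, .inl ⟨by omega, by omega, .inr ⟨hx, rfl, hxn⟩⟩⟩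
      · obtain ⟨a, ha⟩ := X.cov hx (by omega)
        have := X.M_b ha
        exact ⟨a, .inl ⟨by omega, by omega, .inl ha⟩⟩

end Ctx

theorem mid_of {R : Finset ℤ} {m : ℤ} (ev : Even R.card)
    (h1 : ∀ i ∈ R, R.card < 2 * rk R i → m < i) (h2 : ∀ i ∈ R, 2 * rk R i ≤ R.card → i < m) :
    2 * rk R m = R.card := by
  obtain ⟨t, ht⟩ := ev
  have h0 := rk_le_card R m
  by_cases h : t = 0
  · omega
  obtain ⟨x, hx, hxt⟩ := exists_rk (R := R) (t := t) (by omega) (by omega)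
  obtain ⟨x', hx', hxt'⟩ := exists_rk (R := R) (t := t + 1) (by omega) (by omega)
  have h3 := rk_mono R (h2 x hx (by omega)).le
  have h4 := rk_lt hx' (h1 x' hx' (by omega))
  omega

namespace SetPartitionC

variable {n : ℕ}

theorem arc_pos (P : SetPartitionC n) {x y : ℤ} (h : P.IsArc x y) (hy : 0 < y) :
    0 < x ∧ x < y := by
  have hr := P.isArc_range h
  have h1 := h.1
  have h2 := abs_le.1 hr.1.2
  have h3 := abs_le.1 hr.2.2
  unfold nestOrd at h1
  rw [if_pos hy] at h1
  split_ifs at h1 <;> omega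

theorem pos_nocross {P : SetPartitionC n} (hN : P.NonCrossingD) {a b : ℤ} {q : ℤ × ℤ}
    (h : P.IsArc a b) (hb : 0 < b) (hbn : b < n) (hq : P.IsArc q.1 q.2) :
    ¬ Crosses n (a, b) q := by
  intro hc
  have h1 := P.arc_pos h hb
  have hp : (a, b) ∉ P.pnArcs := by
    unfold pnArcs
    rw [Finset.mem_filter]
    rintro ⟨_, h⟩
    dsimp only at h
    omega
  have e1 : ¬ ContainsN n (a, b) := by unfold ContainsN; dsimp only; omega
  have e2 : ¬ ContainsNegN n (a, b) := by unfold ContainsNegN; dsimp only; omega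
  have := hN.2.1 _ (P.mem_arcs_iff.2 h) q (P.mem_arcs_iff.2 hq) hc
  unfold AllowedCrossD at this
  tauto

end SetPartitionC

namespace Ctx

variable {n : ℕ} {O C : Finset ℤ} {M : Finset (ℤ × ℤ)}

theorem mem_M_iff (X : Ctx n O C M) {P : SetPartitionC n} (hN : P.NonCrossingD)
    (ho : P.openers = O) (hc : P.closers = C) (a b : ℤ) :
    (a, b) ∈ M ↔ P.IsArc a b ∧ 0 < b ∧ b < n := by
  have n2 := X.n2
  obtain ⟨M', hM'⟩ : ∃ M' : Finset (ℤ × ℤ), ∀ a b, (a, b) ∈ M' ↔ P.IsArc a b ∧ 0 < b ∧ b < n := by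
    refine ⟨P.arcs.filter fun p => 0 < p.2 ∧ p.2 < (n : ℤ), fun a b => ?_⟩
    rw [Finset.mem_filter, P.mem_arcs_iff]
  suffices Stack (low n O) (low n C) M' by
    rw [X.st.uniq this, hM']
  have op : ∀ {x y}, P.IsArc x y → 0 < x → x ∈ O := by
    intro x y h hx
    rw [← ho, P.mem_openers_iff]
    exact ⟨hx, y, h⟩
  have cl : ∀ {x y}, P.IsArc y x → 0 < x → x ∈ C := by
    intro x y h hx
    rw [← hc, P.mem_closers_iff]
    exact ⟨hx, y, h⟩
  constructor
  · intro a b h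
    rw [hM'] at h
    have := P.arc_pos h.1 h.2.1
    exact (mem_low n2).2 ⟨op h.1 this.1, by omega, by omega⟩
  · intro a b h
    rw [hM'] at h
    exact (mem_low n2).2 ⟨cl h.1 h.2.1, by omega, by omega⟩
  · intro a b h
    rw [hM'] at h
    exact (P.arc_pos h.1 h.2.1).2
  · intro b hb
    rw [mem_low n2, ← hc, P.mem_closers_iff] at hb
    obtain ⟨⟨h1, a, ha⟩, h2, h3⟩ := hb
    exact ⟨a, (hM' _ _).2 ⟨ha, h1, h3⟩⟩
  · intro a b c h h'
    exact P.isArc_right ((hM' _ _).1 h).1 ((hM' _ _).1 h').1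
  · intro a b c h h'
    exact P.isArc_left ((hM' _ _).1 h).1 ((hM' _ _).1 h').1
  · intro a b a' b' h h' hlt
    rw [hM'] at h h'
    have e1 := P.arc_pos h.1 h.2.1
    have e2 := P.arc_pos h'.1 h'.2.1
    apply P.pos_nocross hN h.1 h.2.1 h.2.2 (q := (a', b')) h'.1
    left
    simp only [CrossRel, cpr]
    rw [crossOrd_pos e1.1, crossOrd_pos e2.1, crossOrd_pos h.2.1, crossOrd_pos h'.2.1]
    omega
  · intro i hi hno a b h hlt
    rw [hM'] at h
    rw [mem_low n2, ← ho, P.mem_openers_iff] at hi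
    obtain ⟨⟨h1, y, hy⟩, h2, h3⟩ := hi
    have e1 := P.arc_pos h.1 h.2.1
    have hry := P.isArc_range hy
    apply P.pos_nocross hN h.1 h.2.1 h.2.2 (q := (i, y)) hy
    left
    simp only [CrossRel, cpr]
    rw [crossOrd_pos e1.1, crossOrd_pos h.2.1, crossOrd_pos h1]
    by_cases hy0 : 0 < y
    · have hyn : ¬ y < n := fun hlt => hno y ((hM' _ _).2 ⟨hy, hy0, hlt⟩)
      rw [crossOrd_pos hy0]
      omega
    · rw [crossOrd_neg (by omega)]
      omega

end Ctx

namespace Ctx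

variable {n : ℕ} {O C : Finset ℤ} {M : Finset (ℤ × ℤ)}

theorem zero_closer {P : SetPartitionC n} (hD : P.IsTypeD)
    (h : P.IsArc n (-n)) : (n : ℤ) ∈ P.closers := by
  have hr := P.isArc_range h
  obtain ⟨h1, B, hB, hx, hy, hc⟩ := h
  have hz : negSet B = B := P.block_eq (P.symm B hB) hB (x := (n : ℤ))
    (SetPartitionC.mem_negSet.2 hy) hx
  have hne := hD B hB hz
  have hsub : ({(n : ℤ), -(n : ℤ)} : Finset ℤ) ⊆ B := by
    intro z hz
    simp only [Finset.mem_insert, Finset.mem_singleton] at hz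
    rcases hz with rfl | rfl <;> assumption
  have hex : ∃ z ∈ B, z ≠ n ∧ z ≠ -n := by
    by_contra hno
    push Not at hno
    apply hne
    have : B = {(n : ℤ), -(n : ℤ)} := by
      apply Finset.Subset.antisymm _ hsub
      intro z hz
      simp only [Finset.mem_insert, Finset.mem_singleton]
      by_cases h : z = n
      · exact .inl h
      · exact .inr (hno z hz h)
    rw [this, Finset.card_pair (by omega)]
  have hex2 : ∃ w ∈ B, 0 < w ∧ w < n := by
    obtain ⟨z, hzB, hz1, hz2⟩ := hex
    have hzr := P.mem_range hB hzB
    have := abs_le.1 hzr.2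
    by_cases h0 : 0 < z
    · exact ⟨z, hzB, h0, by omega⟩
    · refine ⟨-z, ?_, by omega, by omega⟩
      rw [← hz, SetPartitionC.mem_negSet, neg_neg]
      exact hzB
  obtain ⟨w, hw, hw0, hwn⟩ := hex2
  obtain ⟨z, _, hz⟩ := P.exists_prev hB hw hx (by
    unfold nestOrd
    rw [if_pos hw0, if_pos (by omega)]
    exact hwn)
  exact P.mem_closers_iff.2 ⟨by omega, z, hz⟩

set_option maxHeartbeats 1000000 in
theorem classify (X : Ctx n O C M) {P : SetPartitionC n} (hD : P.IsTypeD) (hN : P.NonCrossingD)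
    (ho : P.openers = O) (hc : P.closers = C) :
    ∃ m j, Valid n O C (free n O M) m j ∧ ∀ a b : ℤ, 0 < a → 0 < b →
      (P.IsArc a b ↔ AA n C M m a b) ∧
      (P.IsArc a (-b) ↔ SS n O (RR (free n O M) m j) j a b) := by
  have n2 := X.n2
  have hM := X.mem_M_iff hN ho hc
  have rg : ∀ {x y}, P.IsArc x y → x ≠ 0 ∧ -(n : ℤ) ≤ x ∧ x ≤ n ∧ y ≠ 0 ∧ -(n : ℤ) ≤ y ∧ y ≤ n := by
    intro x y h
    have h := P.isArc_range h
    rw [abs_le, abs_le] at h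
    omega
  have op : ∀ {x y}, P.IsArc x y → 0 < x → x ∈ O := by
    intro x y h hx
    rw [← ho, P.mem_openers_iff]
    exact ⟨hx, y, h⟩
  have cl : ∀ {x y}, P.IsArc y x → 0 < x → x ∈ C := by
    intro x y h hx
    rw [← hc, P.mem_closers_iff]
    exact ⟨hx, y, h⟩
  have op' : ∀ {x}, x ∈ O → ∃ y, P.IsArc x y := by
    intro x hx
    rw [← ho, P.mem_openers_iff] at hx
    exact hx.2
  have neg : ∀ {x y}, P.IsArc x (-y) → P.IsArc y (-x) := by
    intro x y h
    have := P.isArc_neg h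
    rwa [neg_neg] at this
  obtain ⟨m, hm1, hm0⟩ : ∃ m, ((n : ℤ) ∈ C → P.IsArc m n) ∧ ((n : ℤ) ∉ C → m = 0) := by
    by_cases h : (n : ℤ) ∈ C
    · have h2 := h
      rw [← hc, P.mem_closers_iff] at h2
      obtain ⟨_, m, hm⟩ := h2
      exact ⟨m, fun _ => hm, fun h' => absurd h h'⟩
    · exact ⟨0, fun h' => absurd h' h, fun _ => rfl⟩
  obtain ⟨j, hj1, hj0⟩ : ∃ j, ((n : ℤ) ∈ O → P.IsArc n (-j) ∧ 1 ≤ j ∧ j ≤ n) ∧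
      ((n : ℤ) ∉ O → j = 0) := by
    by_cases h : (n : ℤ) ∈ O
    · obtain ⟨y, hy⟩ := op' h
      have hr := rg hy
      have hy0 : ¬ 0 < y := by
        intro h0
        have := P.arc_pos hy h0
        omega
      refine ⟨-y, fun _ => ⟨?_, by omega, by omega⟩, fun h' => absurd h h'⟩
      rwa [neg_neg]
    · exact ⟨0, fun h' => absurd h' h, fun _ => rfl⟩
  have hm2 : (n : ℤ) ∈ C → 1 ≤ m ∧ m < n := by
    intro h
    have := P.arc_pos (hm1 h) (by omega)
    omega
  -- free elements
  have fr : ∀ {x y}, P.IsArc x y → 0 < x → x < n → ¬ (0 < y ∧ y < n) → x ∈ free n O M := by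
    intro x y h hx hxn hy
    rw [X.mem_free]
    refine ⟨op h hx, by omega, hxn, fun b hb => hy ?_⟩
    rw [hM] at hb
    rw [P.isArc_right h hb.1]
    exact hb.2
  have hmf : (n : ℤ) ∈ C → m ∈ free n O M := by
    intro h
    have := hm2 h
    exact fr (hm1 h) (by omega) (by omega) (by omega)
  have hjf : (n : ℤ) ∈ O → j ∈ free n O M ∨ (j = n ∧ (n : ℤ) ∈ C) := by
    intro h
    obtain ⟨h1, h2, h3⟩ := hj1 h
    by_cases hjn : j = n
    · right
      refine ⟨hjn, ?_⟩
      rw [hjn] at h1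
      rw [← hc]
      exact zero_closer hD h1
    · left
      exact fr (neg h1) (by omega) (by omega) (by omega)
  have hne : (n : ℤ) ∈ O → j ≠ m := by
    intro h hjm
    obtain ⟨h1, h2, h3⟩ := hj1 h
    by_cases hnC : (n : ℤ) ∈ C
    · have := neg h1
      rw [hjm] at this
      have := P.isArc_right this (hm1 hnC)
      omega
    · have := hm0 hnC
      omega
  obtain ⟨R, hR⟩ : ∃ R, R = RR (free n O M) m j := ⟨_, rfl⟩
  have hRb : ∀ x ∈ R, 1 ≤ x ∧ x < (n : ℤ) := by
    intro x hx
    rw [hR] at hx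
    have h2 := X.mem_free.1 (mem_RR.1 hx).2.2
    exact ⟨h2.2.1, h2.2.2.1⟩
  have inR : ∀ {a b}, P.IsArc a (-b) → 0 < a → 0 < b → a < n → b < n → a ∈ R := by
    intro a b h ha hb han hbn
    rw [hR, mem_RR]
    refine ⟨?_, ?_, fr h ha han (by omega)⟩
    · intro haj
      by_cases hnO : (n : ℤ) ∈ O
      · have h1 := neg (hj1 hnO).1
        rw [← haj] at h1
        have := P.isArc_right h h1
        omega
      · have := hj0 hnO
        omega
    · intro haj
      by_cases hnC : (n : ℤ) ∈ C
      · have h1 := hm1 hnC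
        rw [← haj] at h1
        have := P.isArc_right h h1
        omega
      · have := hm0 hnC
        omega
  have exR : ∀ i ∈ R, ∃ s, s ∈ R ∧ P.IsArc i (-s) := by
    intro i hi
    have hb := hRb i hi
    rw [hR, mem_RR, X.mem_free] at hi
    obtain ⟨h1, h2, h3, h4, h5, h6⟩ := hi
    obtain ⟨y, hy⟩ := op' h3
    have hr := rg hy
    have hy0 : ¬ 0 < y := by
      intro h0
      by_cases hyn : y = n
      · rw [hyn] at hy
        exact h2 (P.isArc_left hy (hm1 (cl hy (by omega))))
      · exact h6 y ((hM _ _).2 ⟨hy, h0, by omega⟩)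
    have hy2 : P.IsArc i (-(-y)) := by rwa [neg_neg]
    have hyn : -y ≠ n := by
      intro h
      rw [h] at hy2
      have hn := neg hy2
      have := P.isArc_right hn (hj1 (op hn (by omega))).1
      omega
    exact ⟨-y, inR (neg hy2) (by omega) (by omega) (by omega) (by omega), hy2⟩
  choose! σ hσR hσ using exR
  have hσσ : ∀ i ∈ R, σ (σ i) = i := by
    intro i hi
    have := P.isArc_right (hσ _ (hσR i hi)) (neg (hσ i hi))
    omega
  have hpn : ∀ i ∈ R, (i, -σ i) ∈ P.pnArcs := by
    intro i hi
    have h1 := hRb i hi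
    have h2 := hRb _ (hσR i hi)
    unfold SetPartitionC.pnArcs
    rw [Finset.mem_filter, P.mem_arcs_iff]
    refine ⟨hσ i hi, ?_⟩
    dsimp only
    omega
  have har : ∀ i ∈ R, (i, -σ i) ∈ P.arcs := fun i hi => P.mem_arcs_iff.2 (hσ i hi)
  have cN : ∀ i ∈ R, ¬ ContainsN n (i, -σ i) := by
    intro i hi
    have h1 := hRb i hi
    have h2 := hRb _ (hσR i hi)
    unfold ContainsN
    dsimp only
    omega
  have cN' : ∀ i ∈ R, ¬ ContainsNegN n (i, -σ i) := by
    intro i hi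
    have h1 := hRb i hi
    have h2 := hRb _ (hσR i hi)
    unfold ContainsNegN
    dsimp only
    omega
  have hanti : ∀ i ∈ R, ∀ k ∈ R, i < k → σ k < σ i := by
    intro i hi k hk hik
    by_contra hle
    have hne : σ i ≠ σ k := by
      intro h
      have := hσσ i hi
      rw [h, hσσ k hk] at this
      omega
    have b1 := hRb i hi
    have b2 := hRb k hk
    have b3 := hRb _ (hσR i hi)
    have b4 := hRb _ (hσR k hk)
    have := hN.2.1 _ (har i hi) _ (har k hk) (by
        left
        simp only [CrossRel, cpr]
        rw [crossOrd_pos (by omega : 0 < i), crossOrd_pos (by omega : 0 < k),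
          crossOrd_neg (by omega : -σ i < 0), crossOrd_neg (by omega : -σ k < 0)]
        omega)
    have c1 := cN i hi
    have c2 := cN' i hi
    have c3 := cN k hk
    have c4 := cN' k hk
    rcases this with h | h | h | h | h | h
    exacts [c1 h.1, c3 h.1, c2 h.1, c4 h.1, c1 h.1, c3 h.1]
  have hsum : ∀ i ∈ R, rk R i + rk R (σ i) = R.card + 1 := fun i hi => rk_anti hσR hσσ hanti hi
  obtain ⟨hcard, hrank⟩ := pn_card (P := P) (R := R) (by
      rintro ⟨a, b⟩ hp
      unfold SetPartitionC.pnArcs at hp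
      rw [Finset.mem_filter, P.mem_arcs_iff] at hp
      dsimp only at hp
      obtain ⟨h, h1, h2, h3, h4⟩ := hp
      exact inR (b := -b) (by rwa [neg_neg]) h1 (by omega) h2 (by omega))
    (fun i hi => ⟨_, hpn i hi, rfl⟩)
  have hev : Even R.card := by
    by_contra hodd
    rw [Nat.not_even_iff_odd] at hodd
    obtain ⟨t, ht⟩ := hodd
    obtain ⟨x, hx, hxt⟩ := exists_rk (R := R) (t := t + 1) (by omega) (by omega)
    have h1 := hsum x hx
    have h2 : σ x = x := rk_inj (hσR x hx) hx (by omega)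
    have h3 := hσ x hx
    have h4 := hRb x hx
    rw [h2] at h3
    have := hN.1 x (by omega) h3
    omega
  have V : Valid n O C (free n O M) m j := by
    constructor
    · exact hmf
    · exact hm0
    · exact hjf
    · exact hj0
    · exact hne
    · rw [← hR]; exact hev
    · intro hnC
      rw [← hR]
      have b0 := hm2 hnC
      have harc : (m, (n : ℤ)) ∈ P.arcs := P.mem_arcs_iff.2 (hm1 hnC)
      apply mid_of hev
      · intro i hi hlt
        have b1 := hRb i hi
        have b3 := hRb _ (hσR i hi)
        have := hN.2.2.1 _ harc (.inr rfl) _ (hpn i hi) (by rw [hcard, hrank]; exact hlt)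
        simp only [Crosses, CrossRel, cpr] at this
        rw [crossOrd_pos (by omega : 0 < i), crossOrd_pos (by omega : 0 < m),
          crossOrd_neg (by omega : -σ i < 0), crossOrd_pos (by omega : 0 < (n : ℤ))] at this
        omega
      · intro i hi hle
        have b1 := hRb i hi
        have b3 := hRb _ (hσR i hi)
        by_contra hlt
        have hmi : m ≠ i := by
          rintro rfl
          rw [hR, mem_RR] at hi
          exact hi.2.1 rfl
        have hcr : Crosses n (m, (n : ℤ)) (i, -σ i) := by
          left
          simp only [CrossRel, cpr]
          rw [crossOrd_pos (by omega : 0 < i), crossOrd_pos (by omega : 0 < m),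
            crossOrd_neg (by omega : -σ i < 0), crossOrd_pos (by omega : 0 < (n : ℤ))]
          omega
        have := hN.2.1 _ harc _ (har i hi) hcr
        have c1 := cN i hi
        have c2 := cN' i hi
        have c3 : (m, (n : ℤ)) ∉ P.pnArcs := by
          unfold SetPartitionC.pnArcs
          rw [Finset.mem_filter]
          rintro ⟨_, h⟩
          dsimp only at h
          omega
        have c4 : ¬ ContainsNegN n (m, (n : ℤ)) := by
          unfold ContainsNegN
          dsimp only
          omega
        have c5 : ¬ P.pnArcs.card < 2 * P.dRank (i, -σ i) := by
          rw [hcard, hrank]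
          exact not_lt.2 hle
        rcases this with h | h | h | h | h | h
        exacts [c5 h.2.2, c3 h.2.1, c4 h.1, c3 h.2.1, c2 h.2, c1 h.1]
    · intro hjR
      rw [← hR]
      have b0 := X.mem_free.1 hjR
      have hnO : (n : ℤ) ∈ O := by
        by_contra h
        have := hj0 h
        omega
      have harc : (j, -(n : ℤ)) ∈ P.arcs := P.mem_arcs_iff.2 (neg (hj1 hnO).1)
      apply mid_of hev
      · intro i hi hle
        have b1 := hRb i hi
        have b3 := hRb _ (hσR i hi)
        by_contra hlt
        have hmi : j ≠ i := by
          rintro rfl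
          rw [hR, mem_RR] at hi
          exact hi.1 rfl
        have hcr : Crosses n (j, -(n : ℤ)) (i, -σ i) := by
          right
          simp only [CrossRel, cpr]
          rw [crossOrd_pos (by omega : 0 < i), crossOrd_pos (by omega : 0 < j),
            crossOrd_neg (by omega : -σ i < 0), crossOrd_neg (by omega : -(n : ℤ) < 0)]
          omega
        have := hN.2.1 _ harc _ (har i hi) hcr
        have c1 := cN i hi
        have c2 := cN' i hi
        have c3 : (j, -(n : ℤ)) ∉ P.pnArcs := by
          unfold SetPartitionC.pnArcs
          rw [Finset.mem_filter]
          rintro ⟨_, h⟩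
          dsimp only at h
          omega
        have c4 : ¬ ContainsN n (j, -(n : ℤ)) := by
          unfold ContainsN
          dsimp only
          omega
        have c5 : ¬ 2 * P.dRank (i, -σ i) ≤ P.pnArcs.card := by
          rw [hcard, hrank]
          exact not_le.2 hle
        rcases this with h | h | h | h | h | h
        exacts [c4 h.1, c3 h.2.1, c5 h.2.2, c3 h.2.1, c4 h.1, c1 h.1]
      · intro i hi hlt
        have b1 := hRb i hi
        have b3 := hRb _ (hσR i hi)
        have := hN.2.2.2 _ harc (.inr rfl) _ (hpn i hi) (by rw [hcard, hrank]; exact hlt)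
        simp only [Crosses, CrossRel, cpr] at this
        rw [crossOrd_pos (by omega : 0 < i), crossOrd_pos (by omega : 0 < j),
          crossOrd_neg (by omega : -σ i < 0), crossOrd_neg (by omega : -(n : ℤ) < 0)] at this
        omega
  refine ⟨m, j, V, fun a b ha hb => ⟨?_, ?_⟩⟩
  · constructor
    · intro h
      have hr := rg h
      by_cases hbn : b = n
      · rw [hbn] at h
        have hnC := cl h (by omega)
        exact .inr ⟨hnC, P.isArc_left h (hm1 hnC), hbn⟩
      · exact .inl ((hM _ _).2 ⟨h, hb, by omega⟩)
    · rintro (h | ⟨h, rfl, rfl⟩)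
      · exact ((hM _ _).1 h).1
      · exact hm1 h
  · rw [← hR]
    constructor
    · intro h
      have hr := rg h
      by_cases han : a = n
      · rw [han] at h
        have hnO := op h (by omega)
        have := P.isArc_right h (hj1 hnO).1
        exact .inr ⟨hnO, .inl ⟨han, by omega⟩⟩
      · by_cases hbn : b = n
        · rw [hbn] at h
          have h' := neg h
          have hnO := op h' (by omega)
          have := P.isArc_right h' (hj1 hnO).1
          exact .inr ⟨hnO, .inr ⟨by omega, hbn⟩⟩
        · have h1 := inR h ha hb (by omega) (by omega)
          have h2 := P.isArc_right h (hσ a h1)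
          have h3 : b = σ a := by omega
          left
          rw [h3]
          exact ⟨h1, hσR a h1, hsum a h1⟩
    · rintro (⟨h1, h2, h3⟩ | ⟨h, ⟨rfl, rfl⟩ | ⟨rfl, rfl⟩⟩)
      · have h4 := hsum a h1
        rw [rk_inj h2 (hσR a h1) (by omega)]
        exact hσ a h1
      · exact (hj1 h).1
      · exact neg (hj1 h).1

end Ctx

theorem rk_erase_gen (R : Finset ℤ) (m x : ℤ) :
    rk (R.erase m) x + (if m ∈ R ∧ m ≤ x then 1 else 0) = rk R x := by
  by_cases h : m ∈ R
  · simpa [h] using rk_erase h x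
  · simp [h]

theorem card_erase_gen (R : Finset ℤ) (m : ℤ) :
    (R.erase m).card + (if m ∈ R then 1 else 0) = R.card := by
  by_cases h : m ∈ R
  · simpa [h] using Finset.card_erase_add_one h
  · simp [h]

theorem rk_RR (R : Finset ℤ) (m j x : ℤ) :
    rk (RR R m j) x + (if (j ≠ m ∧ j ∈ R) ∧ j ≤ x then 1 else 0) +
      (if m ∈ R ∧ m ≤ x then 1 else 0) = rk R x := by
  unfold RR
  rw [← rk_erase_gen R m x, ← rk_erase_gen (R.erase m) j x]
  simp only [Finset.mem_erase]

theorem card_RR (R : Finset ℤ) (m j : ℤ) :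
    (RR R m j).card + (if j ≠ m ∧ j ∈ R then 1 else 0) + (if m ∈ R then 1 else 0) = R.card := by
  unfold RR
  rw [← card_erase_gen R m, ← card_erase_gen (R.erase m) j]
  simp only [Finset.mem_erase]

/-- Explicit description of the valid pairs. -/
def Chr (n : ℕ) (O C R : Finset ℤ) (m j : ℤ) : Prop :=
  ((n : ℤ) ∉ C ∧ (n : ℤ) ∉ O ∧ m = 0 ∧ j = 0 ∧ Even R.card) ∨
  ((n : ℤ) ∈ C ∧ (n : ℤ) ∉ O ∧ j = 0 ∧ m ∈ R ∧ 2 * rk R m = R.card + 1) ∨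
  ((n : ℤ) ∉ C ∧ (n : ℤ) ∈ O ∧ m = 0 ∧ j ∈ R ∧ 2 * rk R j = R.card + 1) ∨
  ((n : ℤ) ∈ C ∧ (n : ℤ) ∈ O ∧ j = n ∧ m ∈ R ∧ 2 * rk R m = R.card + 1) ∨
  ((n : ℤ) ∈ C ∧ (n : ℤ) ∈ O ∧ m ∈ R ∧ j ∈ R ∧
    ((2 * rk R m = R.card ∧ 2 * rk R j = R.card + 2) ∨
      (2 * rk R m = R.card + 2 ∧ 2 * rk R j = R.card)))

theorem valid_iff {n : ℕ} {O C R : Finset ℤ} {m j : ℤ} (n2 : 2 ≤ n) (h0 : (0 : ℤ) ∉ R)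
    (hn : (n : ℤ) ∉ R) : Valid n O C R m j ↔ Chr n O C R m j := by
  have em := rk_RR R m j m
  have ej := rk_RR R m j j
  have ec := card_RR R m j
  have n0 : (n : ℤ) ≠ 0 := by omega
  constructor
  · intro V
    obtain ⟨t, ht⟩ := V.ev
    unfold Chr
    by_cases hC : (n : ℤ) ∈ C
    · have hm := V.mC hC
      have m1 := V.mid_m hC
      by_cases hO : (n : ℤ) ∈ O
      · have hne := V.ne hO
        rcases V.jO hO with hj | ⟨hj, _⟩
        · have j1 := V.mid_j hj
          simp only [hm, hj, hne, true_and, ne_eq, not_false_eq_true, le_refl, if_true] at em ej ec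
          right; right; right; right
          refine ⟨hC, hO, hm, hj, ?_⟩
          split_ifs at em ej <;> omega
        · have hj' : j ∉ R := by rw [hj]; exact hn
          simp only [hm, hj', true_and, and_false, false_and, le_refl, if_true, if_false] at em ej ec
          right; right; right; left
          exact ⟨hC, hO, hj, hm, by omega⟩
      · have hj := V.jO' hO
        have hj' : j ∉ R := by rw [hj]; exact h0
        simp only [hm, hj', true_and, and_false, false_and, le_refl, if_true, if_false] at em ej ec
        right; left
        exact ⟨hC, hO, hj, hm, by omega⟩
    · have hm := V.mC' hC
      have hm' : m ∉ R := by rw [hm]; exact h0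
      by_cases hO : (n : ℤ) ∈ O
      · have hne := V.ne hO
        rcases V.jO hO with hj | ⟨hj, h⟩
        · have j1 := V.mid_j hj
          simp only [hm', hj, hne, true_and, ne_eq, not_false_eq_true, false_and, le_refl,
            if_true, if_false] at em ej ec
          right; right; left
          exact ⟨hC, hO, hm, hj, by omega⟩
        · exact absurd h hC
      · have hj := V.jO' hO
        have hj' : j ∉ R := by rw [hj]; exact h0
        simp only [hm', hj', and_false, false_and, if_false] at em ej ec
        left
        exact ⟨hC, hO, hm, hj, ⟨t, by omega⟩⟩
  · rintro (⟨hC, hO, hm, hj, t, ht⟩ | ⟨hC, hO, hj, hm, e⟩ | ⟨hC, hO, hm, hj, e⟩ |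
      ⟨hC, hO, hj, hm, e⟩ | ⟨hC, hO, hm, hj, e⟩)
    · have hj' : j ∉ R := by rw [hj]; exact h0
      have hm' : m ∉ R := by rw [hm]; exact h0
      simp only [hm', hj', and_false, false_and, if_false] at em ej ec
      exact ⟨fun h => absurd h hC, fun _ => hm, fun h => absurd h hO, fun _ => hj,
        fun h => absurd h hO, ⟨t, by omega⟩, fun h => absurd h hC, fun h => absurd h hj'⟩
    · have hj' : j ∉ R := by rw [hj]; exact h0
      simp only [hm, hj', true_and, and_false, false_and, le_refl, if_true, if_false] at em ej ec
      exact ⟨fun _ => hm, fun h => absurd hC h, fun h => absurd h hO, fun _ => hj,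
        fun h => absurd h hO, ⟨rk R m - 1, by omega⟩, fun _ => by omega, fun h => absurd h hj'⟩
    · have hm' : m ∉ R := by rw [hm]; exact h0
      have hne : j ≠ m := fun h => hm' (h ▸ hj)
      simp only [hm', hj, hne, true_and, ne_eq, not_false_eq_true, false_and, le_refl,
            if_true, if_false] at em ej ec
      exact ⟨fun h => absurd h hC, fun _ => hm, fun _ => .inl hj, fun h => absurd hO h,
        fun _ => hne, ⟨rk R j - 1, by omega⟩, fun h => absurd h hC, fun _ => by omega⟩
    · have hj' : j ∉ R := by rw [hj]; exact hn
      have hne : j ≠ m := fun h => hj' (h ▸ hm)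
      simp only [hm, hj', true_and, and_false, false_and, le_refl, if_true, if_false] at em ej ec
      exact ⟨fun _ => hm, fun h => absurd hC h, fun _ => .inr ⟨hj, hC⟩, fun h => absurd hO h,
        fun _ => hne, ⟨rk R m - 1, by omega⟩, fun _ => by omega, fun h => absurd h hj'⟩
    · have hne : j ≠ m := by
        rintro rfl
        omega
      have c1 := rk_le_iff (x := m) hj
      have c2 := rk_le_iff (x := j) hm
      simp only [hm, hj, hne, true_and, ne_eq, not_false_eq_true, le_refl, if_true] at em ej ec
      refine ⟨fun _ => hm, fun h => absurd hC h, fun _ => .inl hj, fun h => absurd hO h,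
        fun _ => hne, ⟨R.card / 2 - 1, by omega⟩, fun _ => ?_, fun _ => ?_⟩
      · split_ifs at em ej <;> omega
      · split_ifs at em ej <;> omega

theorem det_eq {n : ℕ} {A S : ℤ → ℤ → Prop} {P Q : SetPartitionC n}
    (hP : ∀ a b : ℤ, 0 < a → 0 < b → (P.IsArc a b ↔ A a b) ∧ (P.IsArc a (-b) ↔ S a b))
    (hQ : ∀ a b : ℤ, 0 < a → 0 < b → (Q.IsArc a b ↔ A a b) ∧ (Q.IsArc a (-b) ↔ S a b)) :
    P = Q := by
  apply SetPartitionC.ext_arcs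
  · intro a b ha hb
    rw [(hP a b ha hb).1, (hQ a b ha hb).1]
  · intro a b ha hb
    rw [(hP a b ha hb).2, (hQ a b ha hb).2]

theorem trel_pos {n : ℕ} {A S : ℤ → ℤ → Prop} {P : SetPartitionC n}
    (hP : ∀ x y : ℤ, P.IsArc x y ↔ TRel A S x y) (a b : ℤ) (ha : 0 < a) (hb : 0 < b) :
    (P.IsArc a b ↔ A a b) ∧ (P.IsArc a (-b) ↔ S a b) := by
  rw [hP, hP]
  unfold TRel
  constructor
  · constructor
    · rintro (h | h | h)
      · exact h.2.2
      · omega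
      · omega
    · exact fun h => .inl ⟨ha, hb, h⟩
  · constructor
    · rintro (h | h | h)
      · omega
      · omega
      · simpa using h.2.2
    · exact fun h => .inr (.inr ⟨ha, by omega, by simpa using h⟩)

theorem card_low {n : ℕ} {S : Finset ℤ} (n2 : 2 ≤ n) (hS : S ⊆ Finset.Icc 1 (n : ℤ)) :
    S.card = (low n S).card + (if (n : ℤ) ∈ S then 1 else 0) := by
  have : low n S = S.erase n := by
    ext x
    rw [mem_low n2, Finset.mem_erase]
    constructor
    · exact fun h => ⟨by omega, h.1⟩
    · intro h
      have := Finset.mem_Icc.1 (hS h.2)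
      exact ⟨h.2, by omega, by omega⟩
  rw [this, card_erase_gen]

theorem stmt12 (n : ℕ) (hn : 2 ≤ n) (O C : Finset ℤ)
    (hO : O ⊆ Finset.Icc 1 (n : ℤ)) (hC : C ⊆ Finset.Icc 1 (n : ℤ))
    (hdom : ∀ k : ℕ, k < n →
      (C ∩ Finset.Icc 1 ((k : ℤ) + 1)).card ≤ (O ∩ Finset.Icc 1 (k : ℤ)).card) :
    ((∃ P : SetPartitionC n,
        P.IsTypeD ∧ P.NonCrossingD ∧ P.openers = O ∧ P.closers = C) ↔
      (Even ((O.card : ℤ) - (C.card : ℤ)) ∨ ((n : ℤ) ∈ O ∧ (n : ℤ) ∈ C))) ∧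
    ((Even ((O.card : ℤ) - (C.card : ℤ)) ∧ (n : ℤ) ∈ O ∧ (n : ℤ) ∈ C) →
      {P : SetPartitionC n |
        P.IsTypeD ∧ P.NonCrossingD ∧ P.openers = O ∧ P.closers = C}.ncard = 2) ∧
    (¬(Even ((O.card : ℤ) - (C.card : ℤ)) ∧ (n : ℤ) ∈ O ∧ (n : ℤ) ∈ C) →
      ∀ P Q : SetPartitionC n,
        P.IsTypeD ∧ P.NonCrossingD ∧ P.openers = O ∧ P.closers = C →
        Q.IsTypeD ∧ Q.NonCrossingD ∧ Q.openers = O ∧ Q.closers = C → P = Q) := by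
  obtain ⟨M, hM⟩ := Stack.exists_stack n O C hdom (n - 1) (by omega)
  have X : Ctx n O C M := ⟨hn, fun x hx => Finset.mem_Icc.1 (hO hx),
    fun x hx => Finset.mem_Icc.1 (hC hx), hM⟩
  obtain ⟨R, hR⟩ : ∃ R, R = free n O M := ⟨_, rfl⟩
  have h0 : (0 : ℤ) ∉ R := by
    rw [hR, X.mem_free]
    omega
  have hnR : (n : ℤ) ∉ R := by
    rw [hR, X.mem_free]
    omega
  have e1 : R.card + (low n C).card = (low n O).card := by rw [hR]; exact hM.card_rest
  have e2 := card_low hn hO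
  have e3 := card_low hn hC
  have hr1 : (n : ℤ) ∈ C → 1 ≤ R.card := by
    intro h
    have h1 := hdom (n - 1) (by omega)
    have h2 : C ∩ Finset.Icc 1 (((n - 1 : ℕ) : ℤ) + 1) = C := by
      rw [Finset.inter_eq_left]
      intro x hx
      have := Finset.mem_Icc.1 (hC hx)
      rw [Finset.mem_Icc]
      omega
    rw [h2] at h1
    change C.card ≤ (low n O).card at h1
    rw [if_pos h] at e3
    omega
  have hev : Even ((O.card : ℤ) - (C.card : ℤ)) ↔
      Even (R.card + (if (n : ℤ) ∈ O then 1 else 0) + (if (n : ℤ) ∈ C then 1 else 0)) := by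
    rw [Int.even_iff, Nat.even_iff]
    split_ifs at e2 e3 ⊢ <;> omega
  have hclass : ∀ P : SetPartitionC n,
      P.IsTypeD ∧ P.NonCrossingD ∧ P.openers = O ∧ P.closers = C →
      ∃ m j, Chr n O C R m j ∧ ∀ a b : ℤ, 0 < a → 0 < b →
      (P.IsArc a b ↔ AA n C M m a b) ∧
      (P.IsArc a (-b) ↔ SS n O (RR R m j) j a b) := by
    rintro P ⟨p1, p2, p3, p4⟩
    obtain ⟨m, j, V, h⟩ := X.classify p1 p2 p3 p4
    rw [← hR] at V h
    exact ⟨m, j, (valid_iff hn h0 hnR).1 V, h⟩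
  have hgood : ∀ m j, Chr n O C R m j → ∃ P : SetPartitionC n,
      (P.IsTypeD ∧ P.NonCrossingD ∧ P.openers = O ∧ P.closers = C) ∧
      ∀ a b : ℤ, 0 < a → 0 < b →
      (P.IsArc a b ↔ AA n C M m a b) ∧
      (P.IsArc a (-b) ↔ SS n O (RR R m j) j a b) := by
    intro m j h
    have V := (valid_iff hn h0 hnR).2 h
    rw [hR] at V
    obtain ⟨P, hP, h⟩ := X.exists_good V
    rw [← hR] at h
    exact ⟨P, hP, trel_pos h⟩
  rw [hev]
  have hmid : ∀ t, 1 ≤ t → t ≤ R.card → ∃ x ∈ R, rk R x = t := fun t h1 h2 => exists_rk h1 h2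
  refine ⟨⟨?_, ?_⟩, ?_, ?_⟩
  · rintro ⟨P, hP⟩
    obtain ⟨m, j, h, _⟩ := hclass P hP
    rw [Nat.even_iff]
    rcases h with ⟨a, b, _, _, c⟩ | ⟨a, b, _, _, c⟩ | ⟨a, b, _, _, c⟩ | ⟨a, b, _⟩ | ⟨a, b, _⟩
    · left
      rw [if_neg a, if_neg b]
      rw [Nat.even_iff] at c
      omega
    · left
      rw [if_pos a, if_neg b]
      omega
    · left
      rw [if_neg a, if_pos b]
      omega
    · exact .inr ⟨b, a⟩
    · exact .inr ⟨b, a⟩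
  · intro h
    suffices ∃ m j, Chr n O C R m j by
      obtain ⟨m, j, h⟩ := this
      obtain ⟨P, hP, _⟩ := hgood m j h
      exact ⟨P, hP⟩
    unfold Chr
    by_cases a : (n : ℤ) ∈ C <;> by_cases b : (n : ℤ) ∈ O
    · have h1 := hr1 a
      by_cases hp : R.card % 2 = 0
      · obtain ⟨x, hx, hx'⟩ := hmid (R.card / 2) (by omega) (by omega)
        obtain ⟨y, hy, hy'⟩ := hmid (R.card / 2 + 1) (by omega) (by omega)
        exact ⟨x, y, .inr (.inr (.inr (.inr ⟨a, b, hx, hy, by omega⟩)))⟩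
      · obtain ⟨x, hx, hx'⟩ := hmid (R.card / 2 + 1) (by omega) (by omega)
        exact ⟨x, n, .inr (.inr (.inr (.inl ⟨a, b, rfl, hx, by omega⟩)))⟩
    · rw [if_neg b, if_pos a, Nat.even_iff] at h
      have h : (R.card + 0 + 1) % 2 = 0 := h.resolve_right (fun h => b h.1)
      obtain ⟨x, hx, hx'⟩ := hmid (R.card / 2 + 1) (by omega) (by omega)
      exact ⟨x, 0, .inr (.inl ⟨a, b, rfl, hx, by omega⟩)⟩
    · rw [if_pos b, if_neg a, Nat.even_iff] at h
      have h : (R.card + 1 + 0) % 2 = 0 := h.resolve_right (fun h => a h.2)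
      obtain ⟨x, hx, hx'⟩ := hmid (R.card / 2 + 1) (by omega) (by omega)
      exact ⟨0, x, .inr (.inr (.inl ⟨a, b, rfl, hx, by omega⟩))⟩
    · rw [if_neg b, if_neg a] at h
      have h : Even (R.card + 0 + 0) := h.resolve_right (fun h => a h.2)
      exact ⟨0, 0, .inl ⟨a, b, rfl, rfl, h⟩⟩
  · rintro ⟨h, b, a⟩
    rw [if_pos b, if_pos a, Nat.even_iff] at h
    have h1 := hr1 a
    obtain ⟨x, hx, hx'⟩ := hmid (R.card / 2) (by omega) (by omega)
    obtain ⟨y, hy, hy'⟩ := hmid (R.card / 2 + 1) (by omega) (by omega)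
    obtain ⟨P, hP, hPa⟩ := hgood x y (.inr (.inr (.inr (.inr ⟨a, b, hx, hy, by omega⟩))))
    obtain ⟨Q, hQ, hQa⟩ := hgood y x (.inr (.inr (.inr (.inr ⟨a, b, hy, hx, by omega⟩))))
    have hPQ : P ≠ Q := by
      intro h
      have hxb := hx
      rw [hR, X.mem_free] at hxb
      have k1 := (hPa x n (by omega) (by omega)).1.2 (.inr ⟨a, rfl, rfl⟩)
      rw [h, (hQa x n (by omega) (by omega)).1] at k1
      rcases k1 with k1 | ⟨_, k1, _⟩
      · exact hxb.2.2.2 _ k1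
      · rw [k1] at hx'
        omega
    have hset : {P : SetPartitionC n |
        P.IsTypeD ∧ P.NonCrossingD ∧ P.openers = O ∧ P.closers = C} = {P, Q} := by
      ext S
      simp only [Set.mem_setOf_eq, Set.mem_insert_iff, Set.mem_singleton_iff]
      constructor
      · intro hS
        obtain ⟨m, j, hc, hSa⟩ := hclass S hS
        rcases hc with k | k | k | k | ⟨_, _, hm, hj, k⟩
        · exact absurd a k.1
        · exact absurd b k.2.1
        · exact absurd a k.1
        · omega
        · rcases k with k | k
          · obtain rfl := rk_inj hm hx (by omega)
            obtain rfl := rk_inj hj hy (by omega)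
            exact .inl (det_eq hSa hPa)
          · obtain rfl := rk_inj hm hy (by omega)
            obtain rfl := rk_inj hj hx (by omega)
            exact .inr (det_eq hSa hQa)
      · rintro (rfl | rfl)
        · exact hP
        · exact hQ
    rw [hset, Set.ncard_pair hPQ]
  · intro hno P Q hP hQ
    obtain ⟨m, j, hc, hPa⟩ := hclass P hP
    obtain ⟨m', j', hc', hQa⟩ := hclass Q hQ
    suffices m = m' ∧ j = j' by
      obtain ⟨rfl, rfl⟩ := this
      exact det_eq hPa hQa
    unfold Chr at hc hc'
    by_cases a : (n : ℤ) ∈ C <;> by_cases b : (n : ℤ) ∈ O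
    · rw [if_pos a, if_pos b, Nat.even_iff] at hno
      have hno : ¬ (R.card + 1 + 1) % 2 = 0 := fun h => hno ⟨h, b, a⟩
      simp only [a, b, not_true_eq_false, false_and, true_and, false_or] at hc hc'
      rcases hc with hc | hc
      · rcases hc' with hc' | hc'
        · exact ⟨rk_inj hc.2.1 hc'.2.1 (by omega), by omega⟩
        · omega
      · omega
    · simp only [a, b, not_true_eq_false, not_false_eq_true, false_and, true_and, false_or,
        or_false] at hc hc'
      exact ⟨rk_inj hc.2.1 hc'.2.1 (by omega), by omega⟩
    · simp only [a, b, not_true_eq_false, not_false_eq_true, false_and, true_and, false_or,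
        or_false] at hc hc'
      exact ⟨by omega, rk_inj hc.2.1 hc'.2.1 (by omega)⟩
    · simp only [a, b, not_false_eq_true, false_and, true_and, or_false] at hc hc'
      exact ⟨by omega, by omega⟩
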